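/- arXiv:1108.4381 — 2 statements merged into one kernel-verified Lean document; each statement's English description precedes it below -/
import Mathlib

section
/- If U is a D_p-massive subset of V, then the closure of i(U) in Sp(BD_p(Γ)) contains at least one point of the p-harmonic boundary ∂_p(Γ). -/
open Filter Topology
open scoped ENNReal

namespace PHB

variable {V : Type*}

/-- A graph has bounded degree if there is a uniform finite bound on the
number of neighbors of each vertex. -/
def BoundedDegree (G : SimpleGraph V) : Prop :=
  ∃ k : ℕ, ∀ x : V, (G.neighborSet x).Finite ∧ (G.neighborSet x).ncard ≤ k

/-- The `p`-Dirichlet sum of `f` over a set `S` of vertices: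
`∑_{x ∈ S} ∑_{y ∈ N_x} |f y - f x| ^ p`, valued in `ℝ≥0∞`. -/
noncomputable def IpOn (G : SimpleGraph V) (p : ℝ) (S : Set V) (f : V → ℝ) : ℝ≥0∞ :=
  ∑' x : S, ∑' y : G.neighborSet (x : V), ENNReal.ofReal (|f (y : V) - f (x : V)| ^ p)

/-- The total `p`-Dirichlet sum `I_p(f, V)`. -/
noncomputable def Ip (G : SimpleGraph V) (p : ℝ) (f : V → ℝ) : ℝ≥0∞ :=
  IpOn G p Set.univ f

/-- `D_p(Γ)`: real functions with finite `p`-Dirichlet sum. -/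
def Dirichlet (G : SimpleGraph V) (p : ℝ) : Set (V → ℝ) :=
  {f | Ip G p f ≠ ∞}

/-- `ℓ^∞(Γ)`: bounded real functions on the vertices. -/
def BddFun : Set (V → ℝ) :=
  {f | ∃ C : ℝ, ∀ x, |f x| ≤ C}

/-- `BD_p(Γ) = D_p(Γ) ∩ ℓ^∞(Γ)`. -/
def BDp (G : SimpleGraph V) (p : ℝ) : Set (V → ℝ) :=
  Dirichlet G p ∩ BddFun

/-- The sup norm `‖f‖_∞`. -/
noncomputable def supNorm [Nonempty V] (f : V → ℝ) : ℝ :=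
  ⨆ x, |f x|

/-- The norm `‖f‖_{BD_p} = I_p(f,V)^{1/p} + ‖f‖_∞` on `BD_p(Γ)`. -/
noncomputable def BDpNorm [Nonempty V] (G : SimpleGraph V) (p : ℝ) (f : V → ℝ) : ℝ :=
  (Ip G p f).toReal ^ (1 / p) + supNorm f

/-- The norm `‖f‖_{D_p} = (I_p(f,V) + |f o|^p)^{1/p}` on `D_p(Γ)`, for a fixed vertex `o`. -/
noncomputable def DpNorm (G : SimpleGraph V) (p : ℝ) (o : V) (f : V → ℝ) : ℝ :=
  ((Ip G p f).toReal + |f o| ^ p) ^ (1 / p)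

/-- The `p`-Laplacian `Δ_p f (x) = ∑_{y ∈ N_x} |f y - f x|^{p-2} (f y - f x)`
(with the convention that a summand vanishes when `f y = f x`). -/
noncomputable def pLap (G : SimpleGraph V) (p : ℝ) (f : V → ℝ) (x : V) : ℝ :=
  ∑' y : G.neighborSet x, |f (y : V) - f x| ^ (p - 2) * (f (y : V) - f x)

/-- `BHD_p(Γ)`: bounded `p`-harmonic functions with finite `p`-Dirichlet sum. -/
def BHDp (G : SimpleGraph V) (p : ℝ) : Set (V → ℝ) :=
  {f | f ∈ BDp G p ∧ ∀ x, pLap G p f x = 0}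

/-- The outer boundary `∂S`: vertices outside `S` with a neighbor in `S`. -/
def outerBoundary (G : SimpleGraph V) (S : Set V) : Set V :=
  {x | x ∉ S ∧ ∃ y ∈ S, G.Adj x y}

/-- A set of vertices is connected if the induced subgraph is connected. -/
def ConnectedSubset (G : SimpleGraph V) (S : Set V) : Prop :=
  (G.induce S).Connected

/-- `C` is a connected component of `S`: a maximal connected subset of `S`. -/
def IsComponentOf (G : SimpleGraph V) (C S : Set V) : Prop :=
  C.Nonempty ∧ C ⊆ S ∧ ConnectedSubset G C ∧
    ∀ C', C ⊆ C' → C' ⊆ S → ConnectedSubset G C' → C' = C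

/-- `u` is an inner potential for `U`: a nonnegative member of `BD_p(Γ)` that is
`p`-harmonic on `U`, vanishes on `∂U`, and has supremum `1` over `U`. -/
def InnerPotential (G : SimpleGraph V) (p : ℝ) (U : Set V) (u : V → ℝ) : Prop :=
  u ∈ BDp G p ∧ (∀ x, 0 ≤ u x) ∧ (∀ x ∈ U, pLap G p u x = 0) ∧
    (∀ x ∈ outerBoundary G U, u x = 0) ∧ IsLUB (u '' U) 1

/-- A `D_p`-massive subset: an infinite connected set with nonempty outer
boundary admitting an inner potential. -/
def DpMassive (G : SimpleGraph V) (p : ℝ) (U : Set V) : Prop :=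
  U.Infinite ∧ ConnectedSubset G U ∧ (outerBoundary G U).Nonempty ∧
    ∃ u, InnerPotential G p U u

/-- A character of the Banach algebra `BD_p(Γ)`: a nonzero (equivalently,
unital) ring homomorphism `BD_p(Γ) → ℂ`. -/
structure PCharacter (G : SimpleGraph V) (p : ℝ) where
  toFun : {f : V → ℝ // f ∈ BDp G p} → ℂ
  map_add' : ∀ f g h : {f : V → ℝ // f ∈ BDp G p},
    (h : V → ℝ) = (f : V → ℝ) + (g : V → ℝ) → toFun h = toFun f + toFun g
  map_mul' : ∀ f g h : {f : V → ℝ // f ∈ BDp G p},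
    (h : V → ℝ) = (f : V → ℝ) * (g : V → ℝ) → toFun h = toFun f * toFun g
  map_one' : ∀ h : {f : V → ℝ // f ∈ BDp G p}, (h : V → ℝ) = 1 → toFun h = 1

/-- `Sp(BD_p(Γ))` carries the weak-* topology: the topology of pointwise
convergence on elements of `BD_p(Γ)`. -/
noncomputable instance (G : SimpleGraph V) (p : ℝ) : TopologicalSpace (PCharacter G p) :=
  TopologicalSpace.induced (fun χ => χ.toFun) inferInstance

/-- The evaluation map `i : V → Sp(BD_p(Γ))`, `(i x) f = f x`. -/
def evalChar (G : SimpleGraph V) (p : ℝ) (x : V) : PCharacter G p where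
  toFun f := ((f : V → ℝ) x : ℂ)
  map_add' f g h hh := by
    show ((h : V → ℝ) x : ℂ) = ((f : V → ℝ) x : ℂ) + ((g : V → ℝ) x : ℂ)
    rw [hh]; push_cast [Pi.add_apply]; ring
  map_mul' f g h hh := by
    show ((h : V → ℝ) x : ℂ) = ((f : V → ℝ) x : ℂ) * ((g : V → ℝ) x : ℂ)
    rw [hh]; push_cast [Pi.mul_apply]; ring
  map_one' h hh := by
    show ((h : V → ℝ) x : ℂ) = 1
    rw [hh]; simp

/-- The closure of `C_c(Γ)` in `(D_p(Γ), ‖·‖_{D_p})`. -/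
def CcClosure (G : SimpleGraph V) (p : ℝ) (o : V) : Set (V → ℝ) :=
  {f | f ∈ Dirichlet G p ∧ ∀ ε > 0, ∃ g : V → ℝ,
      (Function.support g).Finite ∧ DpNorm G p o (f - g) < ε}

/-- `B(C̄_c)`: the bounded elements of the `D_p`-closure of `C_c(Γ)`. -/
def BCc (G : SimpleGraph V) (p : ℝ) (o : V) : Set (V → ℝ) :=
  CcClosure G p o ∩ BddFun

/-- The `p`-Royden boundary `R_p(Γ) = Sp(BD_p(Γ)) \ i(V)`. -/
def RoydenBoundary (G : SimpleGraph V) (p : ℝ) : Set (PCharacter G p) :=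
  (Set.range (evalChar G p))ᶜ

/-- The `p`-harmonic boundary
`∂_p(Γ) = {χ ∈ R_p(Γ) : χ f = 0 for all f ∈ B(C̄_c)}`. -/
def pHarmonicBoundary (G : SimpleGraph V) (p : ℝ) (o : V) : Set (PCharacter G p) :=
  {χ | χ ∈ RoydenBoundary G p ∧ ∀ f : {f : V → ℝ // f ∈ BDp G p},
      (f : V → ℝ) ∈ BCc G p o → χ.toFun f = 0}

/-- One-sided infinite self-avoiding paths in the subgraph induced on `A`. -/
def IsPathIn (G : SimpleGraph V) (A : Set V) (γ : ℕ → V) : Prop :=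
  Function.Injective γ ∧ (∀ n, G.Adj (γ n) (γ (n + 1))) ∧ ∀ n, γ n ∈ A

/-- `P_A`: the family of one-sided infinite self-avoiding paths in `Γ_A`. -/
def pathsIn (G : SimpleGraph V) (A : Set V) : Set (ℕ → V) :=
  {γ | IsPathIn G A γ}

/-- The `p`-modulus `λ_p(Q)⁻¹` of a path family `Q`: the infimum of
`∑_{e ∈ E} ρ(e)^p` over all densities `ρ` with `∑_{e ∈ Ed(γ)} ρ(e) ≥ 1`
for every `γ ∈ Q`.  `λ_p(Q) = ∞` corresponds to `pModulus Q = 0`. -/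
noncomputable def pModulus (G : SimpleGraph V) (p : ℝ) (Q : Set (ℕ → V)) : ℝ≥0∞ :=
  ⨅ (ρ : Sym2 V → ℝ≥0∞)
    (_ : ∀ γ ∈ Q, 1 ≤ ∑' n : ℕ, ρ s(γ n, γ (n + 1))),
      ∑' e : G.edgeSet, ρ (e : Sym2 V) ^ p

/-- A property `P` holds for `p`-almost every path in `Q` if the family of
paths of `Q` failing `P` has infinite extremal length (zero `p`-modulus). -/
def AlmostEvery (G : SimpleGraph V) (p : ℝ) (Q : Set (ℕ → V)) (P : (ℕ → V) → Prop) : Prop :=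
  pModulus G p {γ ∈ Q | ¬ P γ} = 0

/-- `f(γ) = c` for `p`-almost every path `γ ∈ P_A`. -/
def AsympConst (G : SimpleGraph V) (p : ℝ) (A : Set V) (f : V → ℝ) (c : ℝ) : Prop :=
  AlmostEvery G p (pathsIn G A)
    (fun γ => Tendsto (fun n => f (γ n)) atTop (nhds c))

/-- A set has property AC if every function in `BHD_p(Γ)` is asymptotically
constant on it. -/
def PropertyAC (G : SimpleGraph V) (p : ℝ) (A : Set V) : Prop :=
  ∀ h ∈ BHDp G p, ∃ c : ℝ, AsympConst G p A h c

/-- The `p`-capacity `Cap_p(A, ∞, S)`: the infimum of `I_p(u, S)` over functions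
`u` that are finitely supported on `S ∪ ∂S` and equal to `1` on `A`. -/
noncomputable def pCapacity (G : SimpleGraph V) (p : ℝ) (A S : Set V) : ℝ≥0∞ :=
  ⨅ (u : V → ℝ)
    (_ : ((S ∪ outerBoundary G S) ∩ Function.support u).Finite ∧ ∀ x ∈ A, u x = 1),
      IpOn G p S u

/-- An infinite connected set `S` is `p`-hyperbolic if `Cap_p(A, ∞, S) > 0` for
some nonempty finite set `A`. -/
def pHyperbolic (G : SimpleGraph V) (p : ℝ) (S : Set V) : Prop :=
  S.Infinite ∧ ConnectedSubset G S ∧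
    ∃ A : Set V, A.Finite ∧ A.Nonempty ∧ 0 < pCapacity G p A S

end PHB

open PHB Filter Topology

namespace PHB

variable {V : Type*} {G : SimpleGraph V} {p : ℝ}

open Classical in
/-- The discrete gradient of `f`, extended by zero to nonadjacent pairs. -/
noncomputable def grad (G : SimpleGraph V) (f : V → ℝ) (z : V × V) : ℝ :=
  if G.Adj z.1 z.2 then f z.2 - f z.1 else 0

/-- Every finite partial sum of the `p`-Dirichlet sum of `f` is at most `M`. -/
def EnergyLE (G : SimpleGraph V) (p : ℝ) (f : V → ℝ) (M : ℝ) : Prop :=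
  ∀ T : Finset (V × V), ∑ z ∈ T, |grad G f z| ^ p ≤ M

/-- `f` is a pointwise limit of finitely supported functions of uniformly bounded energy. -/
def WeaklyApprox (G : SimpleGraph V) (p : ℝ) (f : V → ℝ) : Prop :=
  ∃ (g : ℕ → V → ℝ) (M : ℝ), (∀ k, (Function.support (g k)).Finite) ∧
    (∀ k, EnergyLE G p (g k) M) ∧ ∀ x, Tendsto (fun k => g k x) atTop (𝓝 (f x))

theorem grad_of_adj {x y : V} (h : G.Adj x y) (f : V → ℝ) : grad G f (x, y) = f y - f x := by
  simp [grad, h]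

theorem grad_of_not_adj {x y : V} (h : ¬ G.Adj x y) (f : V → ℝ) : grad G f (x, y) = 0 := by
  simp [grad, h]

theorem Ip_eq_tsum_grad (hp : 0 < p) (f : V → ℝ) :
    Ip G p f = ∑' z : V × V, ENNReal.ofReal (|grad G f z| ^ p) := by
  rw [Ip, IpOn, tsum_univ (fun x => ∑' y : G.neighborSet x, ENNReal.ofReal (|f y - f x| ^ p)),
    ENNReal.tsum_prod']
  refine tsum_congr fun x => ?_
  rw [tsum_subtype (G.neighborSet x) (fun y => ENNReal.ofReal (|f y - f x| ^ p))]
  refine tsum_congr fun y => ?_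
  by_cases h : G.Adj x y
  · simp [Set.indicator, grad_of_adj h, h]
  · simp [Set.indicator, grad_of_not_adj h, h, Real.zero_rpow hp.ne']

theorem pLap_eq_tsum_grad (f : V → ℝ) (x : V) :
    pLap G p f x = ∑' y, |grad G f (x, y)| ^ (p - 2) * grad G f (x, y) := by
  rw [pLap, tsum_subtype (G.neighborSet x) (fun y => |f y - f x| ^ (p - 2) * (f y - f x))]
  refine tsum_congr fun y => ?_
  by_cases h : G.Adj x y
  · simp [Set.indicator, grad_of_adj h, h]
  · simp [Set.indicator, grad_of_not_adj h, h]

theorem energyLE_of_Ip_ne_top (hp : 0 < p) {f : V → ℝ} (hf : Ip G p f ≠ ∞) :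
    EnergyLE G p f (Ip G p f).toReal := by
  intro T
  rw [← ENNReal.ofReal_le_iff_le_toReal hf, ENNReal.ofReal_sum_of_nonneg
    (fun _ _ => by positivity), Ip_eq_tsum_grad hp]
  exact ENNReal.sum_le_tsum T

theorem EnergyLE.summable {f : V → ℝ} {M : ℝ} (h : EnergyLE G p f M) :
    Summable fun z => |grad G f z| ^ p :=
  summable_of_sum_le (fun _ => by positivity) h

theorem EnergyLE.Ip_ne_top (hp : 0 < p) {f : V → ℝ} {M : ℝ} (h : EnergyLE G p f M) :
    Ip G p f ≠ ∞ := by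
  rw [Ip_eq_tsum_grad hp]
  exact h.summable.tsum_ofReal_ne_top

theorem EnergyLE.of_abs_grad_le (hp : 0 < p) {f g : V → ℝ} {M : ℝ} (h : EnergyLE G p g M)
    (hfg : ∀ x y, G.Adj x y → |f y - f x| ≤ |g y - g x|) : EnergyLE G p f M := by
  refine fun T => (Finset.sum_le_sum fun z _ => ?_).trans (h T)
  obtain ⟨x, y⟩ := z
  refine Real.rpow_le_rpow (abs_nonneg _) ?_ hp.le
  by_cases hxy : G.Adj x y
  · simpa only [grad_of_adj hxy] using hfg x y hxy
  · simp [grad_of_not_adj hxy]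

theorem add_rpow_le_two_rpow_mul (hp : 0 < p) {a b : ℝ} (ha : 0 ≤ a) (hb : 0 ≤ b) :
    (a + b) ^ p ≤ 2 ^ p * (a ^ p + b ^ p) := by
  have hm : (max a b) ^ p ≤ a ^ p + b ^ p := by
    have := Real.rpow_nonneg ha p
    have := Real.rpow_nonneg hb p
    rcases max_cases a b with ⟨h, _⟩ | ⟨h, _⟩ <;> rw [h] <;> linarith
  calc (a + b) ^ p ≤ (2 * max a b) ^ p := by
        refine Real.rpow_le_rpow (by positivity) ?_ hp.le
        linarith [le_max_left a b, le_max_right a b]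
    _ = 2 ^ p * (max a b) ^ p := Real.mul_rpow (by norm_num) (le_max_of_le_left ha)
    _ ≤ _ := by gcongr

theorem EnergyLE.of_abs_grad_le_add (hp : 0 < p) {f g h : V → ℝ} {M N : ℝ}
    (hg : EnergyLE G p g M) (hh : EnergyLE G p h N)
    (hf : ∀ x y, G.Adj x y → |f y - f x| ≤ |g y - g x| + |h y - h x|) :
    EnergyLE G p f (2 ^ p * (M + N)) := by
  intro T
  calc ∑ z ∈ T, |grad G f z| ^ p
      ≤ ∑ z ∈ T, 2 ^ p * (|grad G g z| ^ p + |grad G h z| ^ p) := by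
        refine Finset.sum_le_sum fun z _ => ?_
        obtain ⟨x, y⟩ := z
        refine le_trans (Real.rpow_le_rpow (abs_nonneg _) ?_ hp.le)
          (add_rpow_le_two_rpow_mul hp (abs_nonneg _) (abs_nonneg _))
        by_cases hxy : G.Adj x y
        · simpa only [grad_of_adj hxy] using hf x y hxy
        · simp [grad_of_not_adj hxy]
    _ = 2 ^ p * (∑ z ∈ T, |grad G g z| ^ p + ∑ z ∈ T, |grad G h z| ^ p) := by
        rw [← Finset.mul_sum, Finset.sum_add_distrib]
    _ ≤ _ := by
        have := hg T
        have := hh T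
        gcongr

theorem finite_setOf_adj_of_finite (hdeg : BoundedDegree G) {S : Set V} (hS : S.Finite) :
    {z : V × V | z.1 ∈ S ∧ G.Adj z.1 z.2}.Finite := by
  obtain ⟨k, hk⟩ := hdeg
  refine (hS.biUnion fun x _ => (Set.finite_singleton x).prod (hk x).1).subset ?_
  rintro ⟨x, y⟩ ⟨hx, hxy⟩
  simp only [Set.mem_iUnion]
  exact ⟨x, hx, rfl, hxy⟩

theorem finite_support_grad (hdeg : BoundedDegree G) {g : V → ℝ}
    (hg : (Function.support g).Finite) : (Function.support (grad G g)).Finite := by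
  have h := finite_setOf_adj_of_finite hdeg hg
  refine (h.union (h.image Prod.swap)).subset ?_
  rintro ⟨x, y⟩ hz
  have hxy : G.Adj x y := by
    by_contra hn
    exact hz (grad_of_not_adj hn g)
  by_cases hx : g x = 0
  · refine Or.inr ⟨(y, x), ⟨fun hy => hz ?_, hxy.symm⟩, rfl⟩
    rw [grad_of_adj hxy, hx, hy, sub_zero]
  · exact Or.inl ⟨hx, hxy⟩

theorem exists_energyLE_of_finite_support (hdeg : BoundedDegree G) (hp : 0 < p) {g : V → ℝ}
    (hg : (Function.support g).Finite) : ∃ M, EnergyLE G p g M := by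
  have hfin : (Function.support fun z => |grad G g z| ^ p).Finite := by
    refine (finite_support_grad hdeg hg).subset fun z hz hz0 => hz ?_
    simp [hz0, Real.zero_rpow hp.ne']
  have hs : Summable fun z => |grad G g z| ^ p := summable_of_hasFiniteSupport hfin
  exact ⟨∑' z, |grad G g z| ^ p, fun T => hs.sum_le_tsum T fun _ _ => by positivity⟩

theorem abs_sub_le_DpNorm (hp : 0 < p) (o : V) {f : V → ℝ} (hf : Ip G p f ≠ ∞) {x y : V}
    (h : G.Adj x y) : |f y - f x| ≤ DpNorm G p o f := by
  rw [DpNorm, one_div, Real.le_rpow_inv_iff_of_pos (abs_nonneg _) (by positivity) hp]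
  have := energyLE_of_Ip_ne_top hp hf {(x, y)}
  rw [Finset.sum_singleton, grad_of_adj h] at this
  have := Real.rpow_nonneg (abs_nonneg (f o)) p
  linarith

theorem abs_base_le_DpNorm (hp : 0 < p) (o : V) (f : V → ℝ) : |f o| ≤ DpNorm G p o f := by
  rw [DpNorm, one_div, Real.le_rpow_inv_iff_of_pos (abs_nonneg _) (by positivity) hp]
  linarith [ENNReal.toReal_nonneg (a := Ip G p f)]

theorem exists_abs_le_mul_DpNorm (hG : G.Connected) (hp : 0 < p) (o x : V) :
    ∃ C : ℝ, ∀ f : V → ℝ, Ip G p f ≠ ∞ → |f x| ≤ C * DpNorm G p o f := by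
  have h := (SimpleGraph.reachable_iff_reflTransGen o x).1 (hG.preconnected o x)
  induction h with
  | refl => exact ⟨1, fun f _ => by simpa using abs_base_le_DpNorm hp o f⟩
  | @tail y z _ hyz ih =>
    obtain ⟨C, hC⟩ := ih
    refine ⟨C + 1, fun f hf => ?_⟩
    have h1 := hC f hf
    have h2 := abs_sub_le_DpNorm hp o hf hyz
    have h3 : |f z| ≤ |f z - f y| + |f y| := by simpa using abs_add_le (f z - f y) (f y)
    linarith

theorem Ip_toReal_le_DpNorm_rpow (hp : 0 < p) (o : V) (f : V → ℝ) :
    (Ip G p f).toReal ≤ DpNorm G p o f ^ p := by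
  have h0 := ENNReal.toReal_nonneg (a := Ip G p f)
  rw [DpNorm, one_div, Real.rpow_inv_rpow (by positivity) hp.ne']
  linarith [Real.rpow_nonneg (abs_nonneg (f o)) p]

theorem weaklyApprox_of_mem_CcClosure (hG : G.Connected) (hdeg : BoundedDegree G) (hp : 0 < p)
    {o : V} {f : V → ℝ} (hf : f ∈ CcClosure G p o) : WeaklyApprox G p f := by
  obtain ⟨hfD, happ⟩ := hf
  choose g hgfin hg using fun k : ℕ => happ (1 / ((k : ℝ) + 1)) (by positivity)
  have hfE := energyLE_of_Ip_ne_top hp hfD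
  have hne : ∀ k, Ip G p (f - g k) ≠ ∞ := fun k => by
    obtain ⟨M, hM⟩ := exists_energyLE_of_finite_support hdeg hp (hgfin k)
    refine (hfE.of_abs_grad_le_add hp hM fun x y _ => ?_).Ip_ne_top hp
    have : (f - g k) y - (f - g k) x = (f y - f x) - (g k y - g k x) := by
      simp only [Pi.sub_apply]; ring
    rw [this]
    exact abs_sub _ _
  have hnorm : ∀ k, 0 ≤ DpNorm G p o (f - g k) := fun k =>
    (abs_nonneg _).trans (abs_base_le_DpNorm hp o _)
  refine ⟨g, 2 ^ p * ((Ip G p f).toReal + 1), hgfin, fun k => ?_, fun x => ?_⟩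
  · have hE : EnergyLE G p (f - g k) 1 := fun T => by
      refine (energyLE_of_Ip_ne_top hp (hne k) T).trans
        ((Ip_toReal_le_DpNorm_rpow hp o _).trans (Real.rpow_le_one (hnorm k) ?_ hp.le))
      refine (hg k).le.trans ?_
      rw [div_le_one (by positivity)]
      linarith [(Nat.cast_nonneg k : (0 : ℝ) ≤ k)]
    refine hfE.of_abs_grad_le_add hp hE fun x y _ => ?_
    have : g k y - g k x = (f y - f x) - ((f - g k) y - (f - g k) x) := by
      simp only [Pi.sub_apply]; ring
    rw [this]
    exact abs_sub _ _
  · obtain ⟨C, hC⟩ := exists_abs_le_mul_DpNorm (p := p) hG hp o x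
    have hlim : Tendsto (fun k : ℕ => |C| * (1 / ((k : ℝ) + 1))) atTop (𝓝 0) := by
      simpa using (tendsto_one_div_add_atTop_nhds_zero_nat (𝕜 := ℝ)).const_mul |C|
    rw [tendsto_iff_dist_tendsto_zero]
    refine squeeze_zero (fun _ => dist_nonneg) (fun k => ?_) hlim
    rw [dist_comm, Real.dist_eq]
    calc |f x - g k x| ≤ C * DpNorm G p o (f - g k) := hC _ (hne k)
      _ ≤ |C| * DpNorm G p o (f - g k) := by
        gcongr
        · exact hnorm k
        · exact le_abs_self C
      _ ≤ _ := by
        have := (hg k).le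
        gcongr

theorem weaklyApprox_zero (hp : 0 < p) : WeaklyApprox G p (fun _ => 0) :=
  ⟨fun _ _ => 0, 0, fun _ => by simp, fun _ T => by simp [grad, Real.zero_rpow hp.ne'],
    fun _ => tendsto_const_nhds⟩

theorem WeaklyApprox.add (hp : 0 < p) {f g : V → ℝ} (hf : WeaklyApprox G p f)
    (hg : WeaklyApprox G p g) : WeaklyApprox G p (fun x => f x + g x) := by
  obtain ⟨a, M, ha, haE, hal⟩ := hf
  obtain ⟨b, N, hb, hbE, hbl⟩ := hg
  refine ⟨fun k x => a k x + b k x, _, fun k => ((ha k).union (hb k)).subset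
    (Function.support_add (a k) (b k)), fun k => (haE k).of_abs_grad_le_add hp (hbE k)
      fun x y _ => ?_, fun x => (hal x).add (hbl x)⟩
  rw [add_sub_add_comm]
  exact abs_add_le _ _

theorem WeaklyApprox.const_mul_abs (hp : 0 < p) {f : V → ℝ} (hf : WeaklyApprox G p f) {c : ℝ}
    (hc : 0 ≤ c) : WeaklyApprox G p (fun x => c * |f x|) := by
  obtain ⟨a, M, ha, haE, hal⟩ := hf
  refine ⟨fun k x => c * |a k x|, c ^ p * M, fun k => (ha k).subset fun x hx hx0 => hx ?_,
    fun k T => ?_, fun x => (hal x).abs.const_mul c⟩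
  · simp [show a k x = 0 from hx0]
  · calc _ ≤ ∑ z ∈ T, c ^ p * |grad G (a k) z| ^ p := by
          refine Finset.sum_le_sum fun z _ => ?_
          obtain ⟨x, y⟩ := z
          rw [← Real.mul_rpow hc (abs_nonneg _)]
          refine Real.rpow_le_rpow (abs_nonneg _) ?_ hp.le
          by_cases hxy : G.Adj x y
          · rw [grad_of_adj hxy, grad_of_adj hxy, ← mul_sub, abs_mul, abs_of_nonneg hc]
            exact mul_le_mul_of_nonneg_left (abs_abs_sub_abs_le _ _) hc
          · simp [grad_of_not_adj hxy]
      _ = c ^ p * ∑ z ∈ T, |grad G (a k) z| ^ p := by rw [Finset.mul_sum]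
      _ ≤ _ := by
          have := haE k T
          gcongr

theorem WeaklyApprox.sum {ι : Type*} (hp : 0 < p) (s : Finset ι) {f : ι → V → ℝ}
    (hf : ∀ i ∈ s, WeaklyApprox G p (f i)) : WeaklyApprox G p (fun x => ∑ i ∈ s, f i x) := by
  classical
  induction s using Finset.induction_on with
  | empty => simpa using weaklyApprox_zero hp
  | insert i s hi ih =>
    simp only [Finset.sum_insert hi]
    exact (hf i (Finset.mem_insert_self i s)).add hp
      (ih fun j hj => hf j (Finset.mem_insert_of_mem hj))

/-- Green's formula for a finitely supported `h` that vanishes wherever `v` is not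
`p`-harmonic. -/
theorem sum_pairing_eq_zero (hdeg : BoundedDegree G) {v h : V → ℝ}
    (hh : (Function.support h).Finite) (hv : ∀ x, h x ≠ 0 → pLap G p v x = 0)
    (T : Finset (V × V)) (hT : Function.support (grad G h) ⊆ T) :
    ∑ z ∈ T, |grad G v z| ^ (p - 2) * grad G v z * grad G h z = 0 := by
  set P : V × V → ℝ := fun z => |grad G v z| ^ (p - 2) * grad G v z * h z.1 with hP
  have hPfin : (Function.support P).Finite := by
    refine (finite_setOf_adj_of_finite hdeg hh).subset ?_
    rintro ⟨x, y⟩ hz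
    refine ⟨fun h0 => hz ?_, ?_⟩
    · simp [hP, show h x = 0 from h0]
    · by_contra hn
      exact hz (by simp [hP, grad_of_not_adj hn])
  have hPs : Summable P := summable_of_hasFiniteSupport hPfin
  have hP0 : ∑' z, P z = 0 := by
    rw [hPs.tsum_prod, ← tsum_zero (α := ℝ) (β := V)]
    refine tsum_congr fun x => ?_
    simp only [hP]
    rw [tsum_mul_right, ← pLap_eq_tsum_grad]
    by_cases hx : h x = 0
    · simp [hx]
    · simp [hv x hx]
  have hswap : ∀ z, |grad G v z| ^ (p - 2) * grad G v z * grad G h z = -(P z + P z.swap) := by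
    rintro ⟨x, y⟩
    by_cases hxy : G.Adj x y
    · simp only [hP, Prod.swap, grad_of_adj hxy, grad_of_adj hxy.symm]
      rw [abs_sub_comm (v x) (v y)]
      ring
    · have hyx : ¬ G.Adj y x := fun h' => hxy h'.symm
      simp [hP, grad_of_not_adj hxy, grad_of_not_adj hyx]
  have hPs' : Summable fun z : V × V => P z.swap :=
    (Equiv.prodComm V V).summable_iff.2 hPs
  have hP0' : ∑' z : V × V, P z.swap = 0 := by
    rw [← hP0]
    exact (Equiv.prodComm V V).tsum_eq P
  have hsum : ∑' z, |grad G v z| ^ (p - 2) * grad G v z * grad G h z = 0 := by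
    rw [tsum_congr hswap, tsum_neg, hPs.tsum_add hPs', hP0, hP0', add_zero, neg_zero]
  rw [← hsum]
  refine (tsum_eq_sum fun z hz => ?_).symm
  have : grad G h z = 0 := by
    by_contra hne
    exact hz (hT hne)
  simp [this]

theorem abs_rpow_mul_self (hp : 1 < p) (c : ℝ) : |c| ^ (p - 2) * |c| = |c| ^ (p - 1) := by
  rcases eq_or_ne c 0 with rfl | hc
  · simp [Real.zero_rpow (sub_pos.2 hp).ne']
  · rw [← Real.rpow_add_one (abs_pos.2 hc).ne']
    congr 1
    ring

theorem young_pairing_nonneg (hp : 1 < p) {K : ℝ} (hK : 0 < K) (b c : ℝ) :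
    0 ≤ K * |c| ^ p + K ^ (1 - p) * |b| ^ p + |c| ^ (p - 2) * c * b := by
  have hp1 : 0 < p - 1 := sub_pos.2 hp
  have hself : ∀ t : ℝ, 0 ≤ t → t ^ p = t ^ (p - 1) * t := fun t ht => by
    rw [← Real.rpow_add_one' ht (by linarith)]
    congr 1
    ring
  have hlow : -(|c| ^ (p - 1) * |b|) ≤ |c| ^ (p - 2) * c * b := by
    rw [← abs_rpow_mul_self hp, mul_assoc, mul_assoc, ← abs_mul, ← mul_neg]
    exact mul_le_mul_of_nonneg_left (neg_abs_le _) (by positivity)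
  have h1 : 0 ≤ K * |c| ^ p := by positivity
  have h2 : 0 ≤ K ^ (1 - p) * |b| ^ p := by positivity
  have hup : |c| ^ (p - 1) * |b| ≤ K * |c| ^ p + K ^ (1 - p) * |b| ^ p := by
    rcases le_total |b| (K * |c|) with hb | hb
    · have : |c| ^ (p - 1) * |b| ≤ |c| ^ (p - 1) * (K * |c|) := by gcongr
      rw [hself |c| (abs_nonneg c)] at h1 ⊢
      linarith
    · have hc : |c| ≤ K⁻¹ * |b| := by
        rw [inv_mul_eq_div, le_div_iff₀ hK]
        linarith
      have : |c| ^ (p - 1) ≤ K ^ (1 - p) * |b| ^ (p - 1) := by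
        calc |c| ^ (p - 1) ≤ (K⁻¹ * |b|) ^ (p - 1) :=
              Real.rpow_le_rpow (abs_nonneg c) hc hp1.le
          _ = _ := by
              rw [Real.mul_rpow (by positivity) (abs_nonneg b), Real.inv_rpow hK.le,
                ← Real.rpow_neg hK.le, neg_sub]
      have := mul_le_mul_of_nonneg_right this (abs_nonneg b)
      rw [hself |b| (abs_nonneg b)] at h2 ⊢
      linarith
  linarith

/-- A function of finite energy that is the pointwise limit of finitely supported functions
of bounded energy, each orthogonal to its `p`-Laplacian, has zero gradient. -/
theorem grad_eq_zero_of_approx (hdeg : BoundedDegree G) (hp : 1 < p) {v : V → ℝ} {N : ℝ}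
    (hvE : EnergyLE G p v N) {h : ℕ → V → ℝ} {M : ℝ}
    (hfin : ∀ k, (Function.support (h k)).Finite) (hE : ∀ k, EnergyLE G p (h k) M)
    (hlim : ∀ x, Tendsto (fun k => h k x) atTop (𝓝 (v x)))
    (hv : ∀ k x, h k x ≠ 0 → pLap G p v x = 0) (z : V × V) : grad G v z = 0 := by
  have hp0 : 0 < p := by linarith
  set I := ∑' z, |grad G v z| ^ p with hI
  have hIE : EnergyLE G p v I := fun T => hvE.summable.sum_le_tsum T fun _ _ => by positivity
  have hgrad : ∀ z, Tendsto (fun k => grad G (h k) z) atTop (𝓝 (grad G v z)) := by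
    rintro ⟨x, y⟩
    by_cases hxy : G.Adj x y
    · simpa only [grad_of_adj hxy] using (hlim y).sub (hlim x)
    · simp [grad_of_not_adj hxy]
  have key : ∀ K : ℝ, 0 < K → I ≤ K ^ (1 - p) * M := by
    intro K hK
    have hfinite : ∀ (T : Finset (V × V)) (k : ℕ),
        ∑ z ∈ T, (K * |grad G v z| ^ p + K ^ (1 - p) * |grad G (h k) z| ^ p +
          |grad G v z| ^ (p - 2) * grad G v z * grad G (h k) z) ≤ K * I + K ^ (1 - p) * M := by
      classical
      intro T k
      have hs := finite_support_grad hdeg (hfin k)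
      refine (Finset.sum_le_sum_of_subset_of_nonneg
        (Finset.subset_union_left (s₂ := hs.toFinset))
        fun z _ _ => young_pairing_nonneg hp hK _ _).trans ?_
      rw [Finset.sum_add_distrib, Finset.sum_add_distrib, ← Finset.mul_sum, ← Finset.mul_sum,
        sum_pairing_eq_zero hdeg (hfin k) (hv k) _ (by
          rw [Finset.coe_union, hs.coe_toFinset]
          exact Set.subset_union_right), add_zero]
      have := hIE (T ∪ hs.toFinset)
      have := hE k (T ∪ hs.toFinset)
      gcongr
    have hT : ∀ T : Finset (V × V), ∑ z ∈ T, (K + 1) * |grad G v z| ^ p ≤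
        K * I + K ^ (1 - p) * M := by
      intro T
      have hl := tendsto_finsetSum T fun z _ =>
        (((hgrad z).abs.rpow_const (p := p) (Or.inr hp0.le)).const_mul (K ^ (1 - p))).const_add
          (K * |grad G v z| ^ p) |>.add
            ((hgrad z).const_mul (|grad G v z| ^ (p - 2) * grad G v z))
      refine le_trans (Finset.sum_le_sum fun z _ => ?_)
        (le_of_tendsto' hl fun k => hfinite T k)
      have h1 : |grad G v z| ^ (p - 2) * grad G v z * grad G v z = |grad G v z| ^ p := by
        rw [mul_assoc, ← abs_mul_abs_self, ← mul_assoc, abs_rpow_mul_self hp,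
          ← Real.rpow_add_one' (abs_nonneg _) (by linarith)]
        congr 1
        ring
      rw [h1]
      have : 0 ≤ K ^ (1 - p) * |grad G v z| ^ p := by positivity
      linarith
    have := (hvE.summable.mul_left (K + 1)).tsum_le_of_sum_le hT
    rw [tsum_mul_left] at this
    linarith
  have hI0 : I ≤ 0 := by
    have ht : Tendsto (fun K : ℝ => K ^ (1 - p) * M) atTop (𝓝 0) := by
      have := (tendsto_rpow_neg_atTop (sub_pos.2 hp)).mul_const M
      simpa using this
    exact ge_of_tendsto ht ((eventually_gt_atTop 0).mono fun K hK => key K hK)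
  have hz : |grad G v z| ^ p ≤ 0 := by
    simpa using (hIE {z}).trans hI0
  have hz0 : |grad G v z| ^ p = 0 := le_antisymm hz (by positivity)
  exact abs_eq_zero.1 ((Real.rpow_eq_zero (abs_nonneg _) hp0.ne').1 hz0)

theorem eq_of_grad_eq_zero (hG : G.Connected) {f : V → ℝ} (hf : ∀ z, grad G f z = 0) (x y : V) :
    f x = f y := by
  have h := (SimpleGraph.reachable_iff_reflTransGen x y).1 (hG.preconnected x y)
  induction h with
  | refl => rfl
  | @tail y z _ hyz ih =>
    have := hf (y, z)
    rw [grad_of_adj hyz] at this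
    linarith

theorem exists_mem_massive_lt_one (hG : G.Connected) (hdeg : BoundedDegree G) (hp : 1 < p)
    {U : Set V} (hU : DpMassive G p U) {F : V → ℝ} (hF : WeaklyApprox G p F) :
    ∃ x ∈ U, F x < 1 := by
  have hp0 : 0 < p := by linarith
  by_contra! hF1
  obtain ⟨-, -, ⟨w, hw⟩, u, ⟨huD, -⟩, hu0, huL, hub, hlub⟩ := hU
  obtain ⟨g, M, hgfin, hgE, hgl⟩ := hF
  set v : V → ℝ := U.indicator u with hv
  have hv0 : ∀ x, 0 ≤ v x := fun x => Set.indicator_nonneg (fun _ _ => hu0 _) x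
  have hvU : ∀ x ∈ U, v x = u x := fun x hx => Set.indicator_of_mem hx u
  have hvU' : ∀ x ∉ U, v x = 0 := fun x hx => Set.indicator_of_notMem hx u
  have hvnear : ∀ x ∈ U, ∀ y, G.Adj x y → v y = u y := fun x hx y hxy => by
    by_cases hy : y ∈ U
    · exact hvU y hy
    · rw [hvU' y hy, hub y ⟨hy, x, hx, hxy.symm⟩]
  have hvE : EnergyLE G p v (Ip G p u).toReal := by
    refine (energyLE_of_Ip_ne_top hp0 huD).of_abs_grad_le hp0 fun x y hxy => ?_
    by_cases hx : x ∈ U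
    · rw [hvU x hx, hvnear x hx y hxy]
    by_cases hy : y ∈ U
    · rw [hvU y hy, hvnear y hy x hxy.symm]
    · simp [hvU' x hx, hvU' y hy]
  have hvL : ∀ x ∈ U, pLap G p v x = 0 := fun x hx => by
    rw [← huL x hx]
    refine tsum_congr fun y => ?_
    rw [hvU x hx, hvnear x hx y y.2]
  have hvF : ∀ x, v x ≤ |F x| := fun x => by
    by_cases hx : x ∈ U
    · rw [hvU x hx]
      exact (hlub.1 ⟨x, hx, rfl⟩).trans ((hF1 x hx).trans (le_abs_self _))
    · rw [hvU' x hx]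
      exact abs_nonneg _
  have hgrad : ∀ z, grad G v z = 0 := by
    refine grad_eq_zero_of_approx hdeg hp hvE (h := fun k x => min (v x) |g k x|)
      (M := 2 ^ p * ((Ip G p u).toReal + M)) (fun k => ?_) (fun k => ?_) (fun x => ?_)
      (fun k x hx => ?_)
    · refine (hgfin k).subset fun x hx hx0 => hx ?_
      simp [show g k x = 0 from hx0, hv0 x]
    · refine hvE.of_abs_grad_le_add hp0 (hgE k) fun x y _ => ?_
      refine (abs_min_sub_min_le_max _ _ _ _).trans (max_le ?_ ?_)
      · exact le_add_of_nonneg_right (abs_nonneg _)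
      · exact (abs_abs_sub_abs_le _ _).trans (le_add_of_nonneg_left (abs_nonneg _))
    · simpa [min_eq_left (hvF x)] using (tendsto_const_nhds (x := v x)).min (hgl x).abs
    · refine hvL x ?_
      by_contra hxU
      exact hx (by simp [hvU' x hxU])
  have hzero : ∀ x ∈ U, u x = 0 := fun x hx => by
    rw [← hvU x hx, eq_of_grad_eq_zero hG hgrad x w, hvU' w hw.1]
  have : (1 : ℝ) ≤ 0 := hlub.2 (by
    rintro _ ⟨x, hx, rfl⟩
    exact (hzero x hx).le)
  linarith

theorem exists_ultrafilter_tendsto_zero (hG : G.Connected) (hdeg : BoundedDegree G) (hp : 1 < p)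
    (o : V) {U : Set V} (hU : DpMassive G p U) :
    ∃ L : Ultrafilter V, U ∈ L ∧ ∀ f ∈ BCc G p o, Tendsto f L (𝓝 0) := by
  have hp0 : 0 < p := by linarith
  let Φ : V → (BCc G p o → ℝ) := fun x f => f.1 x
  have hne : (comap Φ (𝓝 0) ⊓ 𝓟 U).NeBot := by
    rw [inf_principal_neBot_iff]
    rintro _ ⟨t, ht, hts⟩
    rw [nhds_pi, Filter.mem_pi] at ht
    obtain ⟨J, hJ, s, hs, hst⟩ := ht
    choose ε hε hεs using fun f => Metric.mem_nhds_iff.1 (hs f)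
    obtain ⟨x, hxU, hx⟩ := exists_mem_massive_lt_one hG hdeg hp hU
      (WeaklyApprox.sum hp0 hJ.toFinset fun f _ =>
        (weaklyApprox_of_mem_CcClosure hG hdeg hp0 f.2.1).const_mul_abs hp0
          (inv_nonneg.2 (hε f).le))
    refine ⟨x, hts (hst fun f hf => hεs f ?_), hxU⟩
    have hterm := (Finset.single_le_sum (f := fun f : BCc G p o => (ε f)⁻¹ * |f.1 x|)
      (fun f _ => mul_nonneg (inv_nonneg.2 (hε f).le) (abs_nonneg _))
      (hJ.mem_toFinset.2 hf)).trans_lt hx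
    rw [inv_mul_lt_iff₀ (hε f), mul_one] at hterm
    simpa [Φ] using hterm
  refine ⟨@Ultrafilter.of _ _ hne, ?_, fun f hf => ?_⟩
  · exact (Ultrafilter.of_le _).trans inf_le_right (mem_principal_self U)
  · have : Tendsto Φ (@Ultrafilter.of _ _ hne) (𝓝 0) :=
      tendsto_iff_comap.2 ((Ultrafilter.of_le _).trans inf_le_left)
    exact tendsto_pi_nhds.1 this ⟨f, hf⟩

theorem exists_tendsto_of_mem_BddFun (L : Ultrafilter V) {f : V → ℝ} (hf : f ∈ BddFun) :
    ∃ a, Tendsto f L (𝓝 a) := by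
  obtain ⟨C, hC⟩ := hf
  obtain ⟨a, -, ha⟩ := (isCompact_Icc (a := -C) (b := C)).ultrafilter_le_nhds (L.map f)
    (le_principal_iff.2 (mem_map.2 (univ_mem' fun x => abs_le.1 (hC x))))
  exact ⟨a, ha⟩

/-- Every ultrafilter on the vertices defines a character by taking limits. -/
theorem exists_character_of_ultrafilter (G : SimpleGraph V) (p : ℝ) (L : Ultrafilter V) :
    ∃ χ : PCharacter G p, ∀ f : {f : V → ℝ // f ∈ BDp G p},
      Tendsto (fun x => ((f.1 x : ℝ) : ℂ)) L (𝓝 (χ.toFun f)) := by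
  choose a ha using fun f : {f : V → ℝ // f ∈ BDp G p} =>
    exists_tendsto_of_mem_BddFun L f.2.2
  refine ⟨⟨fun f => (a f : ℂ), fun f g h hh => ?_, fun f g h hh => ?_, fun h hh => ?_⟩,
    fun f => (Complex.continuous_ofReal.tendsto _).comp (ha f)⟩
  · have : a h = a f + a g := tendsto_nhds_unique (ha h) (by
      rw [hh]
      exact (ha f).add (ha g))
    simp [this]
  · have : a h = a f * a g := tendsto_nhds_unique (ha h) (by
      rw [hh]
      exact (ha f).mul (ha g))
    simp [this]
  · have : a h = 1 := tendsto_nhds_unique (ha h) (by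
      rw [hh]
      exact tendsto_const_nhds)
    simp [this]

theorem mem_BCc_of_finite_support (hdeg : BoundedDegree G) (hp : 0 < p) (o : V) {g : V → ℝ}
    (hg : (Function.support g).Finite) (hb : g ∈ BddFun) : g ∈ BCc G p o := by
  obtain ⟨M, hM⟩ := exists_energyLE_of_finite_support (p := p) hdeg hp hg
  refine ⟨⟨hM.Ip_ne_top hp, fun ε hε => ⟨g, hg, ?_⟩⟩, hb⟩
  have : Ip G p (0 : V → ℝ) = 0 := by
    simp [Ip_eq_tsum_grad hp, grad, Real.zero_rpow hp.ne']
  simpa [DpNorm, this, Real.zero_rpow hp.ne', Real.zero_rpow (inv_pos.2 hp).ne'] using hε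

end PHB

/-- If `U` is `D_p`-massive, then the closure of `i(U)` in `Sp(BD_p(Γ))`
contains a point of the `p`-harmonic boundary. -/
theorem massive_closure_meets_boundary {V : Type*} [Countable V] [Infinite V] (G : SimpleGraph V)
    (hG : G.Connected) (hdeg : BoundedDegree G) (p : ℝ) (hp : 1 < p)
    (o : V) (U : Set V) (hU : DpMassive G p U) :
    (closure (evalChar G p '' U) ∩ pHarmonicBoundary G p o).Nonempty := by
  classical
  have hp0 : 0 < p := by linarith
  obtain ⟨L, hLU, hL⟩ := exists_ultrafilter_tendsto_zero hG hdeg hp o hU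
  obtain ⟨χ, hχ⟩ := exists_character_of_ultrafilter G p L
  have hvanish : ∀ f : {f : V → ℝ // f ∈ BDp G p}, (f : V → ℝ) ∈ BCc G p o → χ.toFun f = 0 := by
    intro f hf
    refine tendsto_nhds_unique (hχ f) ?_
    simpa [Function.comp_def] using (Complex.continuous_ofReal.tendsto _).comp (hL f hf)
  refine ⟨χ, ?_, ?_, hvanish⟩
  · have ht : Tendsto (evalChar G p) L (𝓝 χ) := by
      rw [nhds_induced, tendsto_comap_iff, tendsto_pi_nhds]
      exact hχ
    exact mem_closure_of_tendsto ht (mem_of_superset hLU fun x hx => ⟨x, hx, rfl⟩)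
  · rintro ⟨x, rfl⟩
    have hδ : (Pi.single x 1 : V → ℝ) ∈ BCc G p o := by
      refine mem_BCc_of_finite_support hdeg hp0 o
        ((Set.finite_singleton x).subset Pi.support_single_subset) ⟨1, fun y => ?_⟩
      by_cases hy : y = x
      · subst hy; simp
      · simp [hy]
    have := hvanish ⟨Pi.single x 1, hδ.1.1, hδ.2⟩ hδ
    simp [evalChar] at this
end

section
/- Let n ∈ ℕ and suppose there is a finite set K ⊆ V such that V \ K has exactly n infinite connected components F_1, F_2, …, F_n (the p-hyperbolic ends of Γ), each of which is p-hyperbolic and has property AC. Then for any real numbers a_1, a_2, …, a_n there exists a unique h ∈ BHD_p(Γ) such that for each i = 1, 2, …, n, h(γ) = a_i for p-almost every path γ ∈ P_{F_i}. -/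
open Filter Topology
open scoped ENNReal

open PHB Filter Topology

namespace PHB

/-- The scalar nonlinearity `t ↦ |t| ^ (p - 2) * t` of the `p`-Laplacian. -/
noncomputable def pFlow (p t : ℝ) : ℝ := |t| ^ (p - 2) * t

lemma pFlow_neg (p t : ℝ) : pFlow p (-t) = -pFlow p t := by
  simp [pFlow]

lemma pFlow_of_nonneg {p t : ℝ} (hp : 1 < p) (ht : 0 ≤ t) : pFlow p t = t ^ (p - 1) := by
  rcases ht.eq_or_lt with rfl | h
  · simp [pFlow, Real.zero_rpow (by linarith : p - 1 ≠ 0)]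
  · rw [pFlow, abs_of_pos h, show p - 1 = (p - 2) + 1 by ring, Real.rpow_add h, Real.rpow_one]

lemma abs_pFlow {p : ℝ} (hp : 1 < p) (t : ℝ) : |pFlow p t| = |t| ^ (p - 1) := by
  rw [← pFlow_of_nonneg hp (abs_nonneg t)]
  simp [pFlow, abs_mul, abs_of_nonneg (Real.rpow_nonneg (abs_nonneg t) _)]

lemma pFlow_strictMono {p : ℝ} (hp : 1 < p) : StrictMono (pFlow p) := by
  have key : ∀ s t : ℝ, 0 ≤ s → s < t → pFlow p s < pFlow p t := fun s t hs hst => by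
    rw [pFlow_of_nonneg hp hs, pFlow_of_nonneg hp (hs.trans hst.le)]
    exact Real.rpow_lt_rpow hs hst (by linarith)
  have zero : pFlow p 0 = 0 := by simp [pFlow]
  intro s t hst
  rcases le_or_gt 0 s with hs | hs
  · exact key s t hs hst
  · have h1 := key 0 (-s) le_rfl (by linarith)
    rw [pFlow_neg, zero] at h1
    rcases le_or_gt 0 t with ht | ht
    · rcases ht.eq_or_lt with rfl | ht
      · rw [zero]; linarith
      · have := key 0 t le_rfl ht
        rw [zero] at this; linarith
    · have := key (-t) (-s) (by linarith) (by linarith)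
      rw [pFlow_neg, pFlow_neg] at this; linarith

/-- Absolute powers with exponent `p > 1` are strictly midpoint convex. -/
lemma abs_midpoint_rpow_lt {p : ℝ} (hp : 1 < p) {a b : ℝ} (hab : a ≠ b) :
    |(a + b) / 2| ^ p < (|a| ^ p + |b| ^ p) / 2 := by
  have hp0 : 0 < p := by linarith
  by_cases h : |a| = |b|
  · have hb : a = -b := (abs_eq_abs.1 h).resolve_left hab
    have hb0 : b ≠ 0 := by rintro rfl; simp at hb; exact hab hb
    have : 0 < |b| ^ p := Real.rpow_pos_of_pos (abs_pos.2 hb0) p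
    rw [h, hb]
    simp only [neg_add_cancel, zero_div, abs_zero, Real.zero_rpow hp0.ne']
    linarith
  · have hle : |(a + b) / 2| ≤ (1 / 2) * |a| + (1 / 2) * |b| := by
      rw [abs_div, abs_two]
      linarith [abs_add_le a b]
    have hs := (strictConvexOn_rpow hp).2 (Set.mem_Ici.2 (abs_nonneg a))
      (Set.mem_Ici.2 (abs_nonneg b)) h (by norm_num : (0 : ℝ) < 1 / 2)
      (by norm_num : (0 : ℝ) < 1 / 2) (by norm_num)
    simp only [smul_eq_mul] at hs
    have := Real.rpow_le_rpow (abs_nonneg _) hle hp0.le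
    linarith

lemma abs_midpoint_rpow_le {p : ℝ} (hp : 1 < p) (a b : ℝ) :
    |(a + b) / 2| ^ p ≤ (|a| ^ p + |b| ^ p) / 2 := by
  rcases eq_or_ne a b with rfl | h
  · simp
  · exact (abs_midpoint_rpow_lt hp h).le

/-- A quantitative form of the strict convexity of `|·| ^ p`. -/
lemma exists_abs_sub_rpow_le {p : ℝ} (hp : 1 < p) {δ : ℝ} (hδ : 0 < δ) :
    ∃ C : ℝ, 0 < C ∧ ∀ a b : ℝ,
      |a - b| ^ p + C * |(a + b) / 2| ^ p ≤ (δ + C / 2) * (|a| ^ p + |b| ^ p) := by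
  have hp0 : 0 < p := by linarith
  have hc : ∀ f : ℝ × ℝ → ℝ, Continuous f → Continuous fun z => |f z| ^ p := fun f hf =>
    hf.abs.rpow_const fun _ => Or.inr hp0.le
  have hcs := hc (fun z => z.1 - z.2) (by fun_prop)
  have hcm := hc (fun z => (z.1 + z.2) / 2) (by fun_prop)
  have hc1 := hc (fun z => z.1) (by fun_prop)
  have hc2 := hc (fun z => z.2) (by fun_prop)
  set S : Set (ℝ × ℝ) := Metric.sphere 0 1 ∩
    {z | δ * (|z.1| ^ p + |z.2| ^ p) ≤ |z.1 - z.2| ^ p} with hS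
  have hScompact : IsCompact S := (isCompact_sphere _ _).inter_right
    (isClosed_le (continuous_const.mul (hc1.add hc2)) hcs)
  have hnorm : ∀ z : ℝ × ℝ, z ∈ Metric.sphere (0 : ℝ × ℝ) 1 → |z.1| ≤ 1 ∧ |z.2| ≤ 1 ∧
      (|z.1| = 1 ∨ |z.2| = 1) := by
    intro z hz
    rw [mem_sphere_zero_iff_norm, Prod.norm_def, Real.norm_eq_abs, Real.norm_eq_abs] at hz
    refine ⟨hz ▸ le_max_left _ _, hz ▸ le_max_right _ _, ?_⟩
    rcases max_choice |z.1| |z.2| with h | h <;> rw [h] at hz <;> simp [hz]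
  have hpos : ∃ c : ℝ, 0 < c ∧ ∀ z ∈ S,
      c ≤ (|z.1| ^ p + |z.2| ^ p) / 2 - |(z.1 + z.2) / 2| ^ p := by
    rcases S.eq_empty_or_nonempty with h | h
    · exact ⟨1, one_pos, by simp [h]⟩
    · obtain ⟨z, hz, hmin⟩ := hScompact.exists_isMinOn h
        (((hc1.add hc2).div_const 2).sub hcm).continuousOn
      refine ⟨_, ?_, fun w hw => hmin hw⟩
      have hne : z.1 ≠ z.2 := by
        intro he
        have h1 : δ * (|z.1| ^ p + |z.2| ^ p) ≤ |z.1 - z.2| ^ p := hz.2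
        have h2 : 0 < |z.1| ^ p + |z.2| ^ p := by
          rcases (hnorm z hz.1).2.2 with h | h <;> rw [h, Real.one_rpow] <;>
          [have := Real.rpow_nonneg (abs_nonneg z.2) p; have := Real.rpow_nonneg (abs_nonneg z.1) p]
          <;> linarith
        rw [he, sub_self, abs_zero, Real.zero_rpow hp0.ne', ← he] at h1
        rw [he] at h2 h1
        nlinarith
      have := abs_midpoint_rpow_lt hp hne
      exact sub_pos.2 this
  obtain ⟨c, hc0, hcS⟩ := hpos
  refine ⟨2 ^ p / c, by positivity, ?_⟩
  have sphere : ∀ z ∈ Metric.sphere (0 : ℝ × ℝ) 1,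
      |z.1 - z.2| ^ p + 2 ^ p / c * |(z.1 + z.2) / 2| ^ p
        ≤ (δ + 2 ^ p / c / 2) * (|z.1| ^ p + |z.2| ^ p) := by
    intro z hz
    have hC : 0 < 2 ^ p / c := by positivity
    by_cases h : z ∈ S
    · have h1 : |z.1 - z.2| ^ p ≤ 2 ^ p := by
        refine Real.rpow_le_rpow (abs_nonneg _) ?_ hp0.le
        have := abs_sub z.1 z.2
        linarith [(hnorm z hz).1, (hnorm z hz).2.1]
      have h2 := mul_le_mul_of_nonneg_left (hcS z h) hC.le
      rw [div_mul_cancel₀ _ hc0.ne'] at h2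
      have h3 : 0 ≤ δ * (|z.1| ^ p + |z.2| ^ p) := by positivity
      nlinarith
    · have h1 : |z.1 - z.2| ^ p < δ * (|z.1| ^ p + |z.2| ^ p) := by
        by_contra hcon
        exact h ⟨hz, not_lt.1 hcon⟩
      have h2 := mul_le_mul_of_nonneg_left (abs_midpoint_rpow_le hp z.1 z.2) hC.le
      nlinarith
  intro a b
  set s : ℝ := ‖((a, b) : ℝ × ℝ)‖ with hs
  rcases eq_or_ne s 0 with h0 | h0
  · have : ((a, b) : ℝ × ℝ) = 0 := norm_eq_zero.1 h0
    obtain ⟨rfl, rfl⟩ := Prod.mk_eq_zero.1 this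
    simp [Real.zero_rpow hp0.ne']
  · have hs0 : 0 < s := lt_of_le_of_ne (norm_nonneg _) (Ne.symm h0)
    have hm := sphere (s⁻¹ • ((a, b) : ℝ × ℝ)) (by
      rw [mem_sphere_zero_iff_norm, norm_smul, norm_inv, ← hs, Real.norm_of_nonneg hs0.le,
        inv_mul_cancel₀ h0])
    have hscale : ∀ t : ℝ, |s⁻¹ * t| ^ p = (s⁻¹) ^ p * |t| ^ p := fun t => by
      rw [abs_mul, abs_of_pos (inv_pos.2 hs0), Real.mul_rpow (inv_pos.2 hs0).le (abs_nonneg _)]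
    simp only [Prod.smul_mk, smul_eq_mul] at hm
    rw [← mul_sub, ← mul_add, mul_div_assoc, hscale, hscale, hscale, hscale] at hm
    have hsp : 0 < (s⁻¹) ^ p := Real.rpow_pos_of_pos (inv_pos.2 hs0) p
    refine le_of_mul_le_mul_left ?_ hsp
    linarith

variable {V : Type*} {G : SimpleGraph V} {p : ℝ}

lemma BoundedDegree.finite_neighborSet (hdeg : BoundedDegree G) (x : V) :
    (G.neighborSet x).Finite :=
  (hdeg.choose_spec x).1

/-- Darts of a graph, as pairs of a vertex and one of its neighbors. -/
def dartEquivSigma (G : SimpleGraph V) : (Σ x : V, G.neighborSet x) ≃ G.Dart where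
  toFun s := ⟨(s.1, s.2), s.2.2⟩
  invFun d := ⟨d.fst, d.snd, d.adj⟩
  left_inv _ := rfl
  right_inv _ := rfl

/-- Reversal of darts as an equivalence. -/
def dartSymmEquiv (G : SimpleGraph V) : G.Dart ≃ G.Dart where
  toFun := SimpleGraph.Dart.symm
  invFun := SimpleGraph.Dart.symm
  left_inv := SimpleGraph.Dart.symm_symm
  right_inv := SimpleGraph.Dart.symm_symm

/-- The variation `|f y - f x|` of a function along an edge. -/
def edgeVariation (f : V → ℝ) : Sym2 V → ℝ :=
  Sym2.lift ⟨fun x y => |f y - f x|, fun _ _ => abs_sub_comm _ _⟩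

@[simp]
lemma edgeVariation_mk (f : V → ℝ) (x y : V) : edgeVariation f s(x, y) = |f y - f x| := rfl

lemma edgeVariation_nonneg (f : V → ℝ) (e : Sym2 V) : 0 ≤ edgeVariation f e := by
  induction e using Sym2.ind with
  | _ x y => exact abs_nonneg _

lemma Ip_eq_tsum_dart (G : SimpleGraph V) (p : ℝ) (f : V → ℝ) :
    Ip G p f = ∑' d : G.Dart, ENNReal.ofReal (|f d.snd - f d.fst| ^ p) := by
  rw [Ip, IpOn, tsum_univ fun x : V =>
    ∑' y : G.neighborSet x, ENNReal.ofReal (|f (y : V) - f x| ^ p),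
    ← (dartEquivSigma G).tsum_eq, ENNReal.tsum_sigma']
  rfl

lemma tsum_edgeSet_le_tsum_dart (F : Sym2 V → ℝ≥0∞) :
    ∑' e : G.edgeSet, F e ≤ ∑' d : G.Dart, F d.edge := by
  have : ∀ e : G.edgeSet, ∃ d : G.Dart, d.edge = e := by
    rintro ⟨e, he⟩
    induction e using Sym2.ind with
    | _ x y => exact ⟨⟨(x, y), he⟩, rfl⟩
  choose c hc using this
  calc ∑' e : G.edgeSet, F e = ∑' e : G.edgeSet, F (c e).edge := by simp only [hc]
    _ ≤ _ := ENNReal.tsum_comp_le_tsum_of_injective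
      (fun e e' h => Subtype.ext (by rw [← hc e, ← hc e', h])) (fun d : G.Dart => F d.edge)

lemma tsum_dart_le_two_mul_tsum_edgeSet (F : Sym2 V → ℝ≥0∞) :
    ∑' d : G.Dart, F d.edge ≤ 2 * ∑' e : G.edgeSet, F e := by
  classical
  have : ∀ e : G.edgeSet, ∃ d : G.Dart, d.edge = e := by
    rintro ⟨e, he⟩
    induction e using Sym2.ind with
    | _ x y => exact ⟨⟨(x, y), he⟩, rfl⟩
  choose c hc using this
  let j : G.Dart → G.edgeSet × Bool := fun d =>
    (⟨d.edge, d.edge_mem⟩, decide (c ⟨d.edge, d.edge_mem⟩ = d))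
  have hj : Function.Injective j := by
    intro d d' h
    obtain ⟨h1, h2⟩ := Prod.ext_iff.1 h
    have h1' : d.edge = d'.edge := congrArg Subtype.val h1
    simp only [j, decide_eq_decide] at h1 h2
    rw [← h1] at h2
    by_cases hd : c ⟨d.edge, d.edge_mem⟩ = d
    · exact hd.symm.trans (h2.1 hd)
    · have hd' : ¬ c ⟨d.edge, d.edge_mem⟩ = d' := fun h => hd (h2.2 h)
      have e1 := ((SimpleGraph.dart_edge_eq_iff _ _).1 (hc ⟨d.edge, d.edge_mem⟩)).resolve_left hd
      have e2 := ((SimpleGraph.dart_edge_eq_iff _ _).1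
        ((hc ⟨d.edge, d.edge_mem⟩).trans h1')).resolve_left hd'
      exact SimpleGraph.Dart.symm_involutive.injective (e1.symm.trans e2)
  calc ∑' d : G.Dart, F d.edge = ∑' d : G.Dart, (fun z : G.edgeSet × Bool => F z.1) (j d) := rfl
    _ ≤ ∑' z : G.edgeSet × Bool, F z.1 :=
      ENNReal.tsum_comp_le_tsum_of_injective hj (fun z : G.edgeSet × Bool => F z.1)
    _ = ∑' e : G.edgeSet, ∑' _ : Bool, F e := 
      ENNReal.tsum_prod (f := fun (e : G.edgeSet) (_ : Bool) => F e)
    _ = 2 * ∑' e : G.edgeSet, F e := by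
      rw [← ENNReal.tsum_mul_left]
      congr with e
      rw [tsum_bool, two_mul]

lemma tsum_edgeVariation_le (hp : 0 ≤ p) (f : V → ℝ) :
    ∑' e : G.edgeSet, ENNReal.ofReal (edgeVariation f e) ^ p ≤ Ip G p f := by
  rw [Ip_eq_tsum_dart]
  refine (tsum_edgeSet_le_tsum_dart fun e => ENNReal.ofReal (edgeVariation f e) ^ p).trans_eq
    (tsum_congr fun d => ?_)
  rw [ENNReal.ofReal_rpow_of_nonneg (edgeVariation_nonneg _ _) hp]
  rfl

/-- `ρ` is admissible for `Q`: every path of `Q` has `ρ`-length at least one. -/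
def Admissible (Q : Set (ℕ → V)) (ρ : Sym2 V → ℝ≥0∞) : Prop :=
  ∀ γ ∈ Q, 1 ≤ ∑' n : ℕ, ρ s(γ n, γ (n + 1))

lemma exists_admissible_of_pModulus_eq_zero {Q : Set (ℕ → V)} (h : pModulus G p Q = 0)
    {ε : ℝ≥0∞} (hε : 0 < ε) :
    ∃ ρ : Sym2 V → ℝ≥0∞, Admissible Q ρ ∧ ∑' e : G.edgeSet, ρ e ^ p < ε := by
  rw [← h, pModulus] at hε
  simp only [iInf_lt_iff] at hε
  obtain ⟨ρ, hρ, hlt⟩ := hε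
  exact ⟨ρ, hρ, hlt⟩

lemma pModulus_le {Q : Set (ℕ → V)} {ρ : Sym2 V → ℝ≥0∞} (h : Admissible Q ρ) :
    pModulus G p Q ≤ ∑' e : G.edgeSet, ρ e ^ p :=
  iInf₂_le ρ h

lemma pModulus_mono_of_tail {Q Q' : Set (ℕ → V)}
    (h : ∀ γ ∈ Q, ∃ k, (fun n => γ (n + k)) ∈ Q') : pModulus G p Q ≤ pModulus G p Q' := by
  refine le_iInf₂ fun ρ hρ => pModulus_le fun γ hγ => ?_
  obtain ⟨k, hk⟩ := h γ hγ
  refine (hρ _ hk).trans ?_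
  have := ENNReal.tsum_comp_le_tsum_of_injective (add_left_injective k)
    fun n => ρ s(γ n, γ (n + 1))
  refine le_trans (le_of_eq (tsum_congr fun n => ?_)) this
  simp only [add_right_comm n 1 k]

lemma pModulus_mono {Q Q' : Set (ℕ → V)} (h : Q ⊆ Q') : pModulus G p Q ≤ pModulus G p Q' :=
  pModulus_mono_of_tail fun _ hγ => ⟨0, h hγ⟩

lemma pModulus_iUnion_eq_zero (hp : 0 < p) {ι : Type*} [Countable ι] {Q : ι → Set (ℕ → V)}
    (h : ∀ i, pModulus G p (Q i) = 0) : pModulus G p (⋃ i, Q i) = 0 := by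
  refine le_antisymm (ENNReal.le_of_forall_pos_le_add fun ε hε _ => ?_) zero_le
  obtain ⟨δ, hδ, hsum⟩ := ENNReal.exists_pos_sum_of_countable
    (ENNReal.coe_pos.2 hε).ne' ι
  choose ρ hρ hlt using fun i =>
    exists_admissible_of_pModulus_eq_zero (h i) (ENNReal.coe_pos.2 (hδ i))
  rw [zero_add]
  refine (pModulus_le (ρ := fun e => ⨆ i, ρ i e) ?_).trans ?_
  · intro γ hγ
    obtain ⟨i, hi⟩ := Set.mem_iUnion.1 hγ
    exact (hρ i γ hi).trans (ENNReal.tsum_le_tsum fun n => le_iSup (fun i => ρ i _) i)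
  · calc ∑' e : G.edgeSet, (⨆ i, ρ i e) ^ p
        ≤ ∑' e : G.edgeSet, ∑' i, ρ i e ^ p := by
          refine ENNReal.tsum_le_tsum fun e => ?_
          rw [← ENNReal.orderIsoRpow_apply p hp, OrderIso.map_iSup]
          exact iSup_le fun i => ENNReal.le_tsum (f := fun i => ρ i e ^ p) i
      _ = ∑' i, ∑' e : G.edgeSet, ρ i e ^ p := ENNReal.tsum_comm
      _ ≤ ∑' i, (δ i : ℝ≥0∞) := ENNReal.tsum_le_tsum fun i => (hlt i).le
      _ ≤ ε := hsum.le

lemma pModulus_union_eq_zero (hp : 0 < p) {Q Q' : Set (ℕ → V)}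
    (h : pModulus G p Q = 0) (h' : pModulus G p Q' = 0) : pModulus G p (Q ∪ Q') = 0 := by
  rw [Set.union_eq_iUnion]
  exact pModulus_iUnion_eq_zero hp (by rintro (_ | _) <;> simpa)

lemma AlmostEvery.mono {Q : Set (ℕ → V)} {P P' : (ℕ → V) → Prop} (h : AlmostEvery G p Q P)
    (hP : ∀ γ ∈ Q, P γ → P' γ) : AlmostEvery G p Q P' :=
  le_antisymm ((pModulus_mono (Q' := {γ ∈ Q | ¬ P γ})
    fun γ hγ => ⟨hγ.1, fun hc => hγ.2 (hP γ hγ.1 hc)⟩).trans_eq h) zero_le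

lemma AlmostEvery.and (hp : 0 < p) {Q : Set (ℕ → V)} {P P' : (ℕ → V) → Prop}
    (h : AlmostEvery G p Q P) (h' : AlmostEvery G p Q P') :
    AlmostEvery G p Q fun γ => P γ ∧ P' γ := by
  refine le_antisymm (le_trans (pModulus_mono fun γ hγ => ?_)
    (pModulus_union_eq_zero hp h h').le) zero_le
  by_cases hc : P γ
  · exact Or.inr ⟨hγ.1, fun hc' => hγ.2 ⟨hc, hc'⟩⟩
  · exact Or.inl ⟨hγ.1, hc⟩

lemma abs_sub_le_sum_edgeVariation (g : V → ℝ) (γ : ℕ → V) (n : ℕ) :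
    |g (γ n) - g (γ 0)| ≤ ∑ i ∈ Finset.range n, edgeVariation g s(γ i, γ (i + 1)) := by
  rw [← Finset.sum_range_sub fun i => g (γ i)]
  exact Finset.abs_sum_le_sum_abs _ _

lemma pModulus_eq_zero_of_tendsto_Ip (hp : 0 < p) {Q : Set (ℕ → V)} {c : ℝ} (hc : 0 < c)
    {g : ℕ → V → ℝ} (hg : Tendsto (fun m => Ip G p (g m)) atTop (𝓝 0))
    (hQ : ∀ᶠ m in atTop, ∀ γ ∈ Q, ∃ n, c ≤ |g m (γ n) - g m (γ 0)|) : pModulus G p Q = 0 := by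
  have hle : ∀ᶠ m in atTop,
      pModulus G p Q ≤ ENNReal.ofReal c⁻¹ ^ p * Ip G p (g m) := by
    filter_upwards [hQ] with m hm
    refine (pModulus_le
      (ρ := fun e => ENNReal.ofReal c⁻¹ * ENNReal.ofReal (edgeVariation (g m) e)) ?_).trans ?_
    · intro γ hγ
      obtain ⟨n, hn⟩ := hm γ hγ
      rw [ENNReal.tsum_mul_left]
      calc (1 : ℝ≥0∞) = ENNReal.ofReal c⁻¹ * ENNReal.ofReal c := by
            rw [← ENNReal.ofReal_mul (inv_pos.2 hc).le, inv_mul_cancel₀ hc.ne', ENNReal.ofReal_one]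
        _ ≤ _ := by
            gcongr
            refine (ENNReal.ofReal_le_ofReal
              (hn.trans (abs_sub_le_sum_edgeVariation (g m) γ n))).trans ?_
            rw [ENNReal.ofReal_sum_of_nonneg fun i _ => edgeVariation_nonneg _ _]
            exact ENNReal.sum_le_tsum _
    · simp only [ENNReal.mul_rpow_of_nonneg _ _ hp.le]
      rw [ENNReal.tsum_mul_left]
      gcongr
      exact tsum_edgeVariation_le hp.le _
  have hlim : Tendsto (fun m => ENNReal.ofReal c⁻¹ ^ p * Ip G p (g m)) atTop (𝓝 0) := by
    simpa using ENNReal.Tendsto.const_mul hg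
      (Or.inr (ENNReal.rpow_ne_top_of_nonneg hp.le ENNReal.ofReal_ne_top))
  exact le_antisymm (ge_of_tendsto hlim hle) zero_le

/-- A function approximated in energy and pointwise by functions `g m` from which it differs only
on finite sets tends to zero along almost every path. -/
lemma almostEvery_tendsto_zero [Countable V] (hp : 0 < p) {Q : Set (ℕ → V)}
    (hinj : ∀ γ ∈ Q, Function.Injective γ) {u : V → ℝ} {g : ℕ → V → ℝ}
    (hg : Tendsto (fun m => Ip G p (g m)) atTop (𝓝 0))
    (hpt : ∀ x, Tendsto (fun m => g m x) atTop (𝓝 0))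
    (hfin : ∀ m, {x | u x ≠ g m x}.Finite) :
    AlmostEvery G p Q fun γ => Tendsto (fun n => u (γ n)) atTop (𝓝 0) := by
  let B : ℕ × V → Set (ℕ → V) := fun z =>
    {γ ∈ Q | γ 0 = z.2 ∧ ∃ᶠ n in atTop, 1 / ((z.1 : ℝ) + 1) ≤ |u (γ n)|}
  have hB : ∀ z, pModulus G p (B z) = 0 := by
    rintro ⟨k, x⟩
    have hk : (0 : ℝ) < 1 / ((k : ℝ) + 1) := by positivity
    refine pModulus_eq_zero_of_tendsto_Ip hp (half_pos hk) hg ?_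
    filter_upwards [(hpt x).abs.eventually (gt_mem_nhds (abs_zero (α := ℝ) ▸ half_pos hk))] with m hm
    rintro γ ⟨hγ, h0, hfreq⟩
    have heq : ∀ᶠ n in atTop, u (γ n) = g m (γ n) := by
      have := ((hinj γ hγ).tendsto_cofinite.eventually (hfin m).eventually_cofinite_notMem)
      rw [Nat.cofinite_eq_atTop] at this
      filter_upwards [this] with n hn
      simpa using hn
    obtain ⟨n, hn, hn'⟩ := (hfreq.and_eventually heq).exists
    refine ⟨n, ?_⟩
    have h0' : γ 0 = x := h0
    simp only at hn
    rw [h0']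
    rw [hn'] at hn
    have := abs_sub_abs_le_abs_sub (g m (γ n)) (g m x)
    linarith
  refine le_antisymm ((pModulus_mono ?_).trans_eq (pModulus_iUnion_eq_zero hp hB)) zero_le
  rintro γ ⟨hγ, hnot⟩
  simp only [Metric.tendsto_atTop'] at hnot
  push Not at hnot
  obtain ⟨ε, hε, hfreq⟩ := hnot
  obtain ⟨k, hk⟩ := exists_nat_one_div_lt hε
  refine Set.mem_iUnion.2 ⟨(k, γ 0), hγ, rfl, frequently_atTop.2 fun N => ?_⟩
  obtain ⟨n, hn, hle⟩ := hfreq N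
  rw [dist_zero_right, Real.norm_eq_abs] at hle
  exact ⟨n, hn.le, hk.le.trans hle⟩

lemma finite_setOf_walk_length_le (hfin : ∀ x, (G.neighborSet x).Finite) (m : ℕ) (x : V) :
    {y | ∃ w : G.Walk x y, w.length ≤ m}.Finite := by
  induction m generalizing x with
  | zero =>
    refine (Set.finite_singleton x).subset ?_
    rintro y ⟨w, hw⟩
    exact (SimpleGraph.Walk.eq_of_length_eq_zero (Nat.le_zero.1 hw)).symm
  | succ m ih =>
    refine ((Set.finite_singleton x).union ((hfin x).biUnion fun z _ => ih z)).subset ?_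
    rintro y ⟨w, hw⟩
    cases w with
    | nil => exact Or.inl rfl
    | cons h w =>
      rw [SimpleGraph.Walk.length_cons] at hw
      exact Or.inr (Set.mem_biUnion h ⟨w, by omega⟩)

lemma injective_edge_of_injective {γ : ℕ → V} (hγ : Function.Injective γ) :
    Function.Injective fun i => s(γ i, γ (i + 1)) := by
  intro i j h
  rcases Sym2.eq_iff.1 h with ⟨h, -⟩ | ⟨h, h'⟩
  · exact hγ h
  · have := hγ h
    have := hγ h'
    omega

open Classical in
/-- A form of König's lemma: long finite self-avoiding paths of bounded `ρ`-length in a locally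
finite graph produce an infinite one. -/
lemma exists_path_of_walks (hfin : ∀ x, (G.neighborSet x).Finite) {U : Set V} {x : V}
    {ρ : Sym2 V → ℝ≥0∞} {c : ℝ≥0∞}
    (h : ∀ m : ℕ, ∃ (y : V) (w : G.Walk x y), w.IsPath ∧ m ≤ w.length ∧ (∀ z ∈ w.support, z ∈ U) ∧
      ∑ e ∈ w.edges.toFinset, ρ e ≤ c) :
    ∃ γ ∈ pathsIn G U, ∑' n : ℕ, ρ s(γ n, γ (n + 1)) ≤ c := by
  choose y w hpath hlen hU hρ using h
  have hlim : ∀ n, ∃ v, ∀ᶠ m in (hyperfilter ℕ : Filter ℕ), (w m).getVert n = v := by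
    intro n
    have hmem : ∀ m, (w m).getVert n ∈ {y | ∃ w : G.Walk x y, w.length ≤ n} := fun m =>
      ⟨(w m).take n, by simp⟩
    have : (⋃ v ∈ {y | ∃ w : G.Walk x y, w.length ≤ n}, {m | (w m).getVert n = v})
        ∈ hyperfilter ℕ := by
      refine Filter.mem_of_superset Filter.univ_mem fun m _ => ?_
      exact Set.mem_biUnion (hmem m) rfl
    obtain ⟨v, -, hv⟩ := (Ultrafilter.finite_biUnion_mem_iff
      (finite_setOf_walk_length_le hfin n x)).1 this
    exact ⟨v, hv⟩
  choose γ hγ using hlim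
  have hge : ∀ n, ∀ᶠ m in (hyperfilter ℕ : Filter ℕ), n ≤ (w m).length := fun n =>
    ((eventually_ge_atTop n).filter_mono Nat.hyperfilter_le_atTop).mono fun m hm => hm.trans (hlen m)
  have hinj : Function.Injective γ := by
    intro i j hij
    obtain ⟨m, ⟨⟨h1, h2⟩, h3⟩, h4⟩ := (((hγ i).and (hγ j)).and (hge i)).and (hge j) |>.exists
    exact (hpath m).getVert_injOn h3 h4 (h1.trans (hij.trans h2.symm))
  refine ⟨γ, ⟨hinj, fun n => ?_, fun n => ?_⟩, ?_⟩
  · obtain ⟨m, ⟨h1, h2⟩, h3⟩ := (((hγ n).and (hγ (n + 1))).and (hge (n + 1))).exists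
    rw [← h1, ← h2]
    exact (w m).adj_getVert_succ h3
  · obtain ⟨m, h1⟩ := (hγ n).exists
    exact h1 ▸ hU m _ ((w m).getVert_mem_support n)
  · refine ENNReal.tsum_le_of_sum_range_le fun N => ?_
    have hall : ∀ᶠ m in (hyperfilter ℕ : Filter ℕ), ∀ i ∈ Finset.range (N + 1),
        (w m).getVert i = γ i := (Filter.eventually_all_finset _).2 fun i _ => hγ i
    obtain ⟨m, h1, h2⟩ := (hall.and (hge N)).exists
    refine le_trans ?_ (hρ m)
    rw [← Finset.sum_image (f := ρ) fun i _ j _ h => injective_edge_of_injective hinj h]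
    refine Finset.sum_le_sum_of_subset fun e he => ?_
    obtain ⟨i, hi, rfl⟩ := Finset.mem_image.1 he
    rw [Finset.mem_range] at hi
    rw [List.mem_toFinset, ← h1 i (Finset.mem_range.2 (by omega)),
      ← h1 (i + 1) (Finset.mem_range.2 (by omega))]
    exact (SimpleGraph.Walk.mk_mem_edges_iff_exists _).2 ⟨i, by omega, rfl⟩

open Classical in
/-- The least `ρ`-length of a walk in `U` from `x` to the complement of the ball of radius `m`
around `o`. -/
noncomputable def exitCost (G : SimpleGraph V) (ρ : Sym2 V → ℝ≥0∞) (U : Set V) (o : V) (m : ℕ)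
    (x : V) : ℝ≥0∞ :=
  ⨅ (y : V) (w : G.Walk x y) (_ : (∀ z ∈ w.support, z ∈ U) ∧ m < G.dist o y),
    ∑ e ∈ w.edges.toFinset, ρ e

lemma exitCost_eq_zero {ρ : Sym2 V → ℝ≥0∞} {U : Set V} {o x : V} {m : ℕ} (hx : x ∈ U)
    (hm : m < G.dist o x) : exitCost G ρ U o m x = 0 := by
  classical
  refine le_antisymm ?_ zero_le
  refine (iInf_le_of_le x (iInf₂_le_of_le SimpleGraph.Walk.nil ⟨by simpa using hx, hm⟩ ?_))
  simp

lemma exitCost_le_add {ρ : Sym2 V → ℝ≥0∞} {U : Set V} {o x y : V} {m : ℕ} (hx : x ∈ U)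
    (hxy : G.Adj x y) : exitCost G ρ U o m x ≤ ρ s(x, y) + exitCost G ρ U o m y := by
  classical
  simp only [exitCost, ENNReal.add_iInf]
  refine le_iInf fun z => le_iInf₂ fun w hw => ?_
  refine (iInf_le_of_le z (iInf₂_le_of_le (SimpleGraph.Walk.cons hxy w) ⟨?_, hw.2⟩ ?_))
  · simpa [hx] using hw.1
  · rw [SimpleGraph.Walk.edges_cons, List.toFinset_cons]
    by_cases he : s(x, y) ∈ w.edges.toFinset
    · rw [Finset.insert_eq_of_mem he]
      exact le_add_self
    · rw [Finset.sum_insert he]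

lemma eventually_one_le_exitCost (hG : G.Connected) (hfin : ∀ x, (G.neighborSet x).Finite)
    {ρ : Sym2 V → ℝ≥0∞} {U : Set V}
    (hρ : ∀ γ ∈ pathsIn G U, 1 < ∑' n : ℕ, ρ s(γ n, γ (n + 1))) (o x : V) :
    ∀ᶠ m in atTop, 1 ≤ exitCost G ρ U o m x := by
  classical
  by_contra hcon
  rw [not_eventually] at hcon
  obtain ⟨γ, hγ, hle⟩ := exists_path_of_walks hfin (U := U) (x := x) (ρ := ρ) (c := 1) fun k => by
    obtain ⟨m, hm, hlt⟩ := frequently_atTop.1 hcon (k + G.dist o x)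
    rw [not_le, exitCost] at hlt
    simp only [iInf_lt_iff] at hlt
    obtain ⟨y, w, ⟨hU, hd⟩, hlt⟩ := hlt
    refine ⟨y, w.bypass, w.bypass_isPath, ?_, fun z hz => hU z (w.support_bypass_subset_support hz),
      le_trans (Finset.sum_le_sum_of_subset fun e he => ?_) hlt.le⟩
    · have h1 := hG.dist_triangle (u := o) (v := x) (w := y)
      have h2 := SimpleGraph.dist_le w.bypass
      omega
    · rw [List.mem_toFinset] at he ⊢
      exact w.edges_bypass_subset_edges he
  exact (hρ γ hγ).not_ge hle

lemma toReal_min_one_sub_le {a b r : ℝ≥0∞} (hr : r ≠ ∞) (h : a ≤ r + b) :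
    (min 1 a).toReal - (min 1 b).toReal ≤ r.toReal := by
  have hb : min 1 b ≠ ∞ := ((min_le_left _ _).trans_lt ENNReal.one_lt_top).ne
  have : min 1 a ≤ r + min 1 b := by
    rcases le_total 1 b with h1 | h1
    · rw [min_eq_left h1]
      exact (min_le_left _ _).trans le_add_self
    · rw [min_eq_right h1]
      exact (min_le_right _ _).trans h
  have := ENNReal.toReal_mono (ENNReal.add_ne_top.2 ⟨hr, hb⟩) this
  rw [ENNReal.toReal_add hr hb] at this
  linarith

/-- Cutoff functions adapted to a set in which every infinite path is `ρ`-long. -/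
lemma exists_cutoff (hG : G.Connected) (hfin : ∀ x, (G.neighborSet x).Finite)
    {ρ : Sym2 V → ℝ≥0∞} (hρtop : ∀ e ∈ G.edgeSet, ρ e ≠ ∞) {U : Set V}
    (hρ : ∀ γ ∈ pathsIn G U, 1 < ∑' n : ℕ, ρ s(γ n, γ (n + 1))) :
    ∃ ψ : ℕ → V → ℝ, (∀ m x, 0 ≤ ψ m x ∧ ψ m x ≤ 1) ∧
      (∀ m, {x ∈ U | ψ m x ≠ 0}.Finite) ∧
      (∀ m, ∀ x ∈ U, ∀ y ∈ U, G.Adj x y → |ψ m y - ψ m x| ≤ (ρ s(x, y)).toReal) ∧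
      ∀ x, ∀ᶠ m in atTop, ψ m x = 1 := by
  obtain ⟨o⟩ := hG.nonempty
  refine ⟨fun m x => (min 1 (exitCost G ρ U o m x)).toReal, fun m x => ⟨ENNReal.toReal_nonneg, ?_⟩,
    fun m => ?_, fun m x hx y hy hxy => ?_, fun x => ?_⟩
  · exact ENNReal.toReal_mono ENNReal.one_ne_top (min_le_left _ _)
  · refine (finite_setOf_walk_length_le hfin m o).subset ?_
    rintro x ⟨hx, hne⟩
    by_contra hcon
    refine hne ?_
    obtain ⟨w, hw⟩ := hG.exists_walk_length_eq_dist o x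
    change (min 1 (exitCost G ρ U o m x)).toReal = 0
    rw [exitCost_eq_zero hx, min_eq_right zero_le, ENNReal.toReal_zero]
    by_contra hlt
    exact hcon ⟨w, by omega⟩
  · rw [abs_sub_le_iff]
    refine ⟨?_, toReal_min_one_sub_le (hρtop _ hxy) (exitCost_le_add hx hxy)⟩
    rw [Sym2.eq_swap]
    exact toReal_min_one_sub_le (hρtop _ hxy.symm) (exitCost_le_add hy hxy.symm)
  · filter_upwards [eventually_one_le_exitCost hG hfin hρ o x] with m hm
    rw [min_eq_left hm, ENNReal.toReal_one]

lemma exists_isPathIn_univ [Infinite V] (hG : G.Connected)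
    (hfin : ∀ x, (G.neighborSet x).Finite) : ∃ γ, IsPathIn G Set.univ γ := by
  by_contra hcon
  obtain ⟨ψ, -, hsupp, hlip, hone⟩ := exists_cutoff hG hfin (ρ := fun _ => 0) (by simp)
    (U := Set.univ) fun γ hγ => (hcon ⟨γ, hγ⟩).elim
  obtain ⟨o⟩ := hG.nonempty
  obtain ⟨m, hm⟩ := (hone o).exists
  have hadj : ∀ x y, G.Adj x y → ψ m x = ψ m y := fun x y hxy => by
    have := hlip m x trivial y trivial hxy
    rw [ENNReal.toReal_zero, abs_nonpos_iff] at this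
    linarith
  refine Set.infinite_univ ((hsupp m).subset fun x _ => ⟨trivial, ?_⟩)
  obtain ⟨w⟩ := hG.preconnected o x
  have : ∀ (x y : V), G.Walk x y → ψ m x = ψ m y := fun x y w => by
    induction w with
    | nil => rfl
    | cons h _ ih => exact (hadj _ _ h).trans ih
  rw [← this o x w, hm]
  exact one_ne_zero

/-- Every vertex of `S` lies in a connected component of `S` containing all connected subsets of
`S` through that vertex. -/
lemma exists_isComponentOf {S : Set V} {x : V} (hx : x ∈ S) :
    ∃ C, IsComponentOf G C S ∧ ∀ T ⊆ S, x ∈ T → ConnectedSubset G T → T ⊆ C := by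
  let 𝒮 : Set (Set V) := {T | T ⊆ S ∧ x ∈ T ∧ ConnectedSubset G T}
  have hsub : ∀ T ⊆ S, x ∈ T → ConnectedSubset G T → T ⊆ ⋃₀ 𝒮 := fun T h1 h2 h3 =>
    Set.subset_sUnion_of_mem ⟨h1, h2, h3⟩
  have hsingle : {x} ∈ 𝒮 := ⟨by simpa using hx, rfl, by
    simp [ConnectedSubset]⟩
  have hxU : x ∈ ⋃₀ 𝒮 := ⟨_, hsingle, rfl⟩
  refine ⟨⋃₀ 𝒮, ⟨⟨x, hxU⟩, Set.sUnion_subset fun T hT => hT.1, ?_, fun C h1 h2 h3 => ?_⟩, hsub⟩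
  · exact SimpleGraph.induce_sUnion_connected_of_pairwise_not_disjoint ⟨_, hsingle⟩
      (fun hs ht => ⟨x, hs.2.1, ht.2.1⟩) fun hs => hs.2.2
  · exact (hsub C h2 (h1 hxU) h3).antisymm h1

lemma connectedSubset_range {γ : ℕ → V} (hγ : ∀ n, G.Adj (γ n) (γ (n + 1))) :
    ConnectedSubset G (Set.range γ) := by
  have hpre : ∀ n, ∃ w : G.Walk (γ 0) (γ n), ∀ z ∈ w.support, z ∈ Set.range γ := by
    intro n
    induction n with
    | zero => exact ⟨SimpleGraph.Walk.nil, by simp⟩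
    | succ n ih =>
      obtain ⟨w, hw⟩ := ih
      refine ⟨w.concat (hγ n), fun z hz => ?_⟩
      rw [SimpleGraph.Walk.support_concat, List.mem_append] at hz
      rcases hz with hz | hz
      · exact hw z hz
      · exact ⟨n + 1, (List.mem_singleton.1 hz).symm⟩
  refine SimpleGraph.induce_connected_of_patches (γ 0) ⟨0, rfl⟩ ?_
  rintro _ ⟨n, rfl⟩
  obtain ⟨w, hw⟩ := hpre n
  exact ⟨{v | v ∈ w.support}, hw, w.start_mem_support, w.end_mem_support,
    w.connected_induce_support.preconnected _ _⟩

lemma IsPathIn.tail {A B : Set V} {γ : ℕ → V} (hγ : IsPathIn G A γ) {k : ℕ}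
    (h : ∀ n, γ (n + k) ∈ B) : IsPathIn G B fun n => γ (n + k) :=
  ⟨hγ.1.comp (add_left_injective k), fun n => by
    simpa only [add_right_comm n 1 k] using hγ.2.1 (n + k), h⟩

lemma IsPathIn.exists_forall_notMem {A K : Set V} {γ : ℕ → V} (hγ : IsPathIn G A γ)
    (hK : K.Finite) : ∃ k, ∀ n, γ (n + k) ∉ K := by
  have := hγ.1.tendsto_cofinite.eventually hK.eventually_cofinite_notMem
  rw [Nat.cofinite_eq_atTop] at this
  obtain ⟨k, hk⟩ := eventually_atTop.1 this
  exact ⟨k, fun n => hk _ (Nat.le_add_left k n)⟩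

/-- An infinite self-avoiding path eventually stays in one infinite component of the complement of
a finite set. -/
lemma IsPathIn.exists_tail_in_component {A K : Set V} {γ : ℕ → V} (hγ : IsPathIn G A γ)
    (hK : K.Finite) :
    ∃ C k, IsComponentOf G C Kᶜ ∧ C.Infinite ∧ IsPathIn G C fun n => γ (n + k) := by
  obtain ⟨k, hk⟩ := hγ.exists_forall_notMem hK
  have htail : IsPathIn G Kᶜ fun n => γ (n + k) := hγ.tail hk
  obtain ⟨C, hC, hmax⟩ := exists_isComponentOf (G := G) (htail.2.2 0)
  have hsub := hmax _ (Set.range_subset_iff.2 htail.2.2) ⟨0, rfl⟩ (connectedSubset_range htail.2.1)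
  exact ⟨C, k, hC, (Set.infinite_range_of_injective htail.1).mono hsub,
    hγ.tail fun n => hsub ⟨n, rfl⟩⟩

lemma IsComponentOf.outerBoundary_subset {C S : Set V} (hC : IsComponentOf G C S) :
    outerBoundary G C ⊆ Sᶜ := by
  rintro x ⟨hx, y, hy, hxy⟩ hxS
  have hconn : ConnectedSubset G (C ∪ {x}) := by
    refine SimpleGraph.connected_induce_union hC.2.2.1.preconnected ?_ hy rfl hxy.symm
    exact SimpleGraph.Preconnected.of_subsingleton
  have := hC.2.2.2 _ Set.subset_union_left
    (Set.union_subset hC.2.1 (Set.singleton_subset_iff.2 hxS)) hconn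
  exact hx (this ▸ Or.inr rfl)

/-- Paths in a `p`-hyperbolic component form a family of positive `p`-modulus. -/
lemma pModulus_pathsIn_ne_zero (hp : 0 < p) (hG : G.Connected)
    (hfin : ∀ x, (G.neighborSet x).Finite) {C K : Set V} (hK : K.Finite)
    (hC : IsComponentOf G C Kᶜ) (hyp : pHyperbolic G p C) : pModulus G p (pathsIn G C) ≠ 0 := by
  classical
  intro hzero
  obtain ⟨-, -, A, hA, -, hcap⟩ := hyp
  refine hcap.ne' (le_antisymm (ENNReal.le_of_forall_pos_le_add fun ε hε _ => ?_) zero_le)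
  have h2 : (2 : ℝ≥0∞) ^ p ≠ ∞ := ENNReal.rpow_ne_top_of_nonneg hp.le (by simp)
  have h20 : (2 : ℝ≥0∞) ^ p ≠ 0 := (ENNReal.rpow_pos (by simp) (by simp)).ne'
  have hzero' : pModulus G p (pathsIn G (C ∪ K)) = 0 := by
    refine le_antisymm ((pModulus_mono_of_tail fun γ hγ => ?_).trans_eq hzero) zero_le
    obtain ⟨k, hk⟩ := IsPathIn.exists_forall_notMem hγ hK
    exact ⟨k, hγ.tail fun n => (hγ.2.2 _).resolve_right (hk n)⟩
  obtain ⟨ρ, hρ, hlt⟩ := exists_admissible_of_pModulus_eq_zero hzero'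
    (ε := ε / (2 * 2 ^ p)) (ENNReal.div_pos (by simpa using hε.ne')
      (ENNReal.mul_ne_top (by simp) h2))
  have hρtop : ∀ e ∈ G.edgeSet, ρ e ≠ ∞ := fun e he htop => by
    have := (ENNReal.le_tsum (f := fun e : G.edgeSet => ρ e ^ p) ⟨e, he⟩).trans_lt hlt
    simp [htop, ENNReal.top_rpow_of_pos hp] at this
  obtain ⟨ψ, -, hsupp, hlip, hone⟩ := exists_cutoff hG hfin (ρ := fun e => 2 * ρ e)
    (fun e he => ENNReal.mul_ne_top (by simp) (hρtop e he)) (U := C ∪ K) fun γ hγ => by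
      rw [ENNReal.tsum_mul_left]
      calc (1 : ℝ≥0∞) < 2 * 1 := by norm_num
        _ ≤ _ := by gcongr; exact hρ γ hγ
  obtain ⟨m, hm⟩ := ((Filter.eventually_all_finite hA).2 fun x _ => hone x).exists
  have hbdry : outerBoundary G C ⊆ K := by simpa using hC.outerBoundary_subset
  have hle : pCapacity G p A C ≤ IpOn G p C (ψ m) :=
    iInf₂_le (ψ m) ⟨(hsupp m).subset fun x hx =>
      ⟨Set.union_subset_union_right _ hbdry hx.1, hx.2⟩, hm⟩
  have hnbr : ∀ x ∈ C, ∀ y, G.Adj x y → y ∈ C ∪ K := fun x hx y hxy => by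
    by_cases hy : y ∈ C
    · exact Or.inl hy
    · exact Or.inr (hbdry ⟨hy, x, hx, hxy.symm⟩)
  rw [zero_add]
  calc pCapacity G p A C ≤ IpOn G p C (ψ m) := hle
    _ ≤ ∑' (x : C) (y : G.neighborSet (x : V)), (2 * ρ s((x : V), (y : V))) ^ p := by
        refine ENNReal.tsum_le_tsum fun x => ENNReal.tsum_le_tsum fun y => ?_
        rw [← ENNReal.ofReal_rpow_of_nonneg (abs_nonneg _) hp.le]
        gcongr
        refine ENNReal.ofReal_le_of_le_toReal ?_
        exact hlip m x (Or.inl x.2) y (hnbr x x.2 y y.2) y.2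
    _ ≤ ∑' (x : V) (y : G.neighborSet x), (2 * ρ s(x, (y : V))) ^ p :=
        ENNReal.tsum_comp_le_tsum_of_injective Subtype.val_injective
          fun x : V => ∑' y : G.neighborSet x, (2 * ρ s(x, (y : V))) ^ p
    _ = ∑' d : G.Dart, (2 * ρ d.edge) ^ p := by
        rw [← (dartEquivSigma G).tsum_eq, ENNReal.tsum_sigma']
        rfl
    _ ≤ 2 * ∑' e : G.edgeSet, (2 * ρ e) ^ p :=
        tsum_dart_le_two_mul_tsum_edgeSet fun e => (2 * ρ e) ^ p
    _ = (2 * 2 ^ p) * ∑' e : G.edgeSet, ρ e ^ p := by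
        simp only [ENNReal.mul_rpow_of_nonneg _ _ hp.le]
        rw [ENNReal.tsum_mul_left, mul_assoc]
    _ ≤ (2 * 2 ^ p) * (ε / (2 * 2 ^ p)) := by gcongr
    _ = ε := ENNReal.mul_div_cancel (mul_ne_zero (by simp) h20) (ENNReal.mul_ne_top (by simp) h2)

lemma Ip_mono (hp : 0 ≤ p) {f g : V → ℝ} (h : ∀ x y, |g y - g x| ≤ |f y - f x|) :
    Ip G p g ≤ Ip G p f :=
  ENNReal.tsum_le_tsum fun _ => ENNReal.tsum_le_tsum fun _ => ENNReal.ofReal_le_ofReal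
    (Real.rpow_le_rpow (abs_nonneg _) (h _ _) hp)

/-- Lower semicontinuity of the Dirichlet sum under pointwise convergence. -/
lemma Ip_le_of_tendsto (hp : 0 ≤ p) {v : ℕ → V → ℝ} {h : V → ℝ} {c : ℝ≥0∞}
    (hv : ∀ x, Tendsto (fun k => v k x) atTop (𝓝 (h x)))
    (hc : ∀ᶠ k in atTop, Ip G p (v k) ≤ c) : Ip G p h ≤ c := by
  rw [Ip_eq_tsum_dart, ENNReal.tsum_eq_iSup_sum]
  refine iSup_le fun s => ?_
  have ht : Tendsto (fun k => ∑ d ∈ s, ENNReal.ofReal (|v k d.snd - v k d.fst| ^ p)) atTop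
      (𝓝 (∑ d ∈ s, ENNReal.ofReal (|h d.snd - h d.fst| ^ p))) :=
    tendsto_finsetSum _ fun d _ =>
      ENNReal.tendsto_ofReal (((hv _).sub (hv _)).abs.rpow_const (Or.inr hp))
  refine le_of_tendsto ht ?_
  filter_upwards [hc] with k hk
  refine (ENNReal.sum_le_tsum s).trans ?_
  rwa [Ip_eq_tsum_dart] at hk

lemma Ip_sub_add_Ip_midpoint_le {δ C : ℝ} (hδ : 0 < δ) (hC : 0 < C)
    (h : ∀ a b : ℝ, |a - b| ^ p + C * |(a + b) / 2| ^ p ≤ (δ + C / 2) * (|a| ^ p + |b| ^ p))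
    (u v : V → ℝ) :
    Ip G p (fun x => u x - v x) + ENNReal.ofReal C * Ip G p (fun x => (u x + v x) / 2) ≤
      ENNReal.ofReal (δ + C / 2) * (Ip G p u + Ip G p v) := by
  simp only [Ip_eq_tsum_dart]
  rw [← ENNReal.tsum_mul_left, ← ENNReal.tsum_add, ← ENNReal.tsum_add, ← ENNReal.tsum_mul_left]
  refine ENNReal.tsum_le_tsum fun d => ?_
  rw [← ENNReal.ofReal_mul hC.le, ← ENNReal.ofReal_add (by positivity) (by positivity),
    ← ENNReal.ofReal_add (by positivity) (by positivity), ← ENNReal.ofReal_mul (by positivity)]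
  refine ENNReal.ofReal_le_ofReal ?_
  have := h (u d.snd - u d.fst) (v d.snd - v d.fst)
  rwa [show u d.snd - u d.fst - (v d.snd - v d.fst) = u d.snd - v d.snd - (u d.fst - v d.fst) by ring,
    show (u d.snd - u d.fst + (v d.snd - v d.fst)) / 2
      = (u d.snd + v d.snd) / 2 - (u d.fst + v d.fst) / 2 by ring] at this

/-- The Dirichlet sum splits into the terms involving `x` and a part independent of the value
at `x`. -/
lemma exists_Ip_update_eq [DecidableEq V] (G : SimpleGraph V) (p : ℝ) (x : V)
    [Fintype (G.neighborSet x)] (f : V → ℝ) :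
    ∃ R : ℝ≥0∞, ∀ s : ℝ, Ip G p (Function.update f x s) =
      2 * ENNReal.ofReal (∑ y : G.neighborSet x, |f y - s| ^ p) + R := by
  refine ⟨∑' d : G.Dart, if d.fst = x ∨ d.snd = x then 0 else
    ENNReal.ofReal (|f d.snd - f d.fst| ^ p), fun s => ?_⟩
  set g := Function.update f x s with hg
  let F : G.Dart → ℝ≥0∞ := fun d => if d.fst = x then ENNReal.ofReal (|g d.snd - g d.fst| ^ p) else 0
  have hF : ∑' d, F d = ENNReal.ofReal (∑ y : G.neighborSet x, |f y - s| ^ p) := by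
    rw [← (dartEquivSigma G).tsum_eq, ENNReal.tsum_sigma', tsum_eq_single x, tsum_fintype,
      ENNReal.ofReal_sum_of_nonneg fun _ _ => by positivity]
    · refine Finset.sum_congr rfl fun y _ => ?_
      have hy : (y : V) ≠ x := (G.ne_of_adj y.2).symm
      simp [F, dartEquivSigma, hg, hy]
    · intro z hz
      simp [F, dartEquivSigma, hz]
  have hFs : ∑' d : G.Dart, F d.symm = ∑' d, F d := (dartSymmEquiv G).tsum_eq F
  rw [two_mul, ← hF]
  nth_rw 2 [← hFs]
  rw [← ENNReal.tsum_add, ← ENNReal.tsum_add, Ip_eq_tsum_dart]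
  refine tsum_congr fun d => ?_
  have hne := d.fst_ne_snd
  by_cases h1 : d.fst = x
  · have h2 : d.snd ≠ x := fun h => hne (h1.trans h.symm)
    simp [F, h1, h2]
  · by_cases h2 : d.snd = x
    · simp [F, h1, h2, abs_sub_comm]
    · simp [F, h1, h2, hg]

lemma pLap_eq_sum (x : V) [Fintype (G.neighborSet x)] (f : V → ℝ) :
    pLap G p f x = ∑ y : G.neighborSet x, pFlow p (f y - f x) :=
  tsum_fintype _

/-- A function whose value at `x` minimizes the local energy is `p`-harmonic at `x`. -/
lemma pLap_eq_zero_of_forall_le (hp : 1 < p) (x : V) [Fintype (G.neighborSet x)] {h : V → ℝ}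
    (hmin : ∀ s : ℝ, ∑ y : G.neighborSet x, |h y - h x| ^ p ≤ ∑ y : G.neighborSet x, |h y - s| ^ p) :
    pLap G p h x = 0 := by
  have hd : HasDerivAt (fun s => ∑ y : G.neighborSet x, |h y - s| ^ p)
      (∑ y : G.neighborSet x, p * |h y - h x| ^ (p - 2) * (h y - h x) * (-1)) (h x) :=
    HasDerivAt.fun_sum fun y _ =>
      (hasDerivAt_abs_rpow (h y - h x) hp).comp (h x) ((hasDerivAt_id (h x)).const_sub (h y))
  have h0 := IsLocalMin.hasDerivAt_eq_zero (Filter.Eventually.of_forall hmin) hd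
  rw [pLap_eq_sum]
  have : ∑ y : G.neighborSet x, p * |h y - h x| ^ (p - 2) * (h y - h x) * (-1)
      = -p * ∑ y : G.neighborSet x, pFlow p (h y - h x) := by
    rw [Finset.mul_sum]
    exact Finset.sum_congr rfl fun y _ => by rw [pFlow]; ring
  rw [this] at h0
  exact (mul_eq_zero.1 h0).resolve_left (by linarith)

/-- Finite perturbations of `f` bounded by `M`. -/
def Competitor (f : V → ℝ) (M : ℝ) : Set (V → ℝ) :=
  {v | {x | v x ≠ f x}.Finite ∧ ∀ x, |v x| ≤ M}

lemma Competitor.midpoint {f : V → ℝ} {M : ℝ} {u v : V → ℝ} (hu : u ∈ Competitor f M)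
    (hv : v ∈ Competitor f M) : (fun x => (u x + v x) / 2) ∈ Competitor f M := by
  refine ⟨(hu.1.union hv.1).subset fun x hx => ?_, fun x => ?_⟩
  · by_contra hcon
    simp only [Set.mem_union, Set.mem_ofPred_eq, not_or, not_not] at hcon
    exact hx (by simp only [hcon.1, hcon.2]; ring)
  · have h1 := abs_le.1 (hu.2 x)
    have h2 := abs_le.1 (hv.2 x)
    exact abs_le.2 ⟨by linarith, by linarith⟩

lemma Competitor.iInf_le_Ip_update [DecidableEq V] (hp : 0 ≤ p) {f : V → ℝ} {M : ℝ}
    (hM : ∀ x, |f x| ≤ M) {v : V → ℝ} (hv : v ∈ Competitor f M) (x : V) (s : ℝ) :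
    ⨅ u ∈ Competitor f M, Ip G p u ≤ Ip G p (Function.update v x s) := by
  have hM0 : 0 ≤ M := (abs_nonneg _).trans (hM x)
  refine iInf₂_le_of_le (fun y => max (-M) (min M (Function.update v x s y))) ⟨?_, fun y => ?_⟩ ?_
  · refine (hv.1.union (Set.finite_singleton x)).subset fun y hy => ?_
    by_contra hcon
    simp only [Set.mem_union, Set.mem_ofPred_eq, Set.mem_singleton_iff, not_or, not_not] at hcon
    refine hy ?_
    have := abs_le.1 (hM y)
    simp only [Function.update_of_ne hcon.2, hcon.1]
    rw [min_eq_right this.2, max_eq_right this.1]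
  · exact abs_le.2 ⟨le_max_left _ _, max_le (by linarith) (min_le_left _ _)⟩
  · refine Ip_mono hp fun y z => ?_
    refine (abs_max_sub_max_le_max _ _ _ _).trans ?_
    rw [sub_self, abs_zero, max_eq_right (abs_nonneg _)]
    refine (abs_min_sub_min_le_max _ _ _ _).trans ?_
    rw [sub_self, abs_zero, max_eq_right (abs_nonneg _)]

/-- Royden decomposition: a bounded function of finite Dirichlet sum is, up to a limit in energy of
finitely supported functions, a bounded `p`-harmonic function of finite Dirichlet sum. -/
lemma exists_mem_BHDp_approx [Countable V] (hp : 1 < p) (hfin : ∀ x, (G.neighborSet x).Finite)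
    {f : V → ℝ} (hf : f ∈ BDp G p) :
    ∃ h ∈ BHDp G p, ∃ v : ℕ → V → ℝ, (∀ m, {x | v m x ≠ f x}.Finite) ∧
      (∀ x, Tendsto (fun m => v m x) atTop (𝓝 (h x))) ∧
      Tendsto (fun m => Ip G p fun x => h x - v m x) atTop (𝓝 0) := by
  classical
  have hp0 : 0 ≤ p := by linarith
  obtain ⟨hfI, M, hM⟩ := hf
  set L : ℝ≥0∞ := ⨅ u ∈ Competitor f M, Ip G p u with hL
  have hfC : f ∈ Competitor f M := ⟨by simp, hM⟩
  have hLf : L ≤ Ip G p f := iInf₂_le f hfC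
  have hLtop : L ≠ ∞ := (hLf.trans_lt (lt_top_iff_ne_top.2 hfI)).ne
  have hmin : ∀ n : ℕ, ∃ v ∈ Competitor f M, Ip G p v < L + ((n : ℝ≥0∞) + 1)⁻¹ := fun n => by
    have : L < L + ((n : ℝ≥0∞) + 1)⁻¹ := ENNReal.lt_add_right hLtop (by simp)
    nth_rw 1 [hL] at this
    simpa only [iInf_lt_iff, exists_prop] using this
  choose w hwC hwL using hmin
  have hcompact : IsCompact (Set.univ.pi fun _ : V => Set.Icc (-M) M) :=
    isCompact_univ_pi fun _ => isCompact_Icc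
  obtain ⟨h, hhM, φ, hφ, hlim⟩ := hcompact.tendsto_subseq (x := w)
    fun n x _ => abs_le.1 ((hwC n).2 x)
  let v : ℕ → V → ℝ := fun n => w (φ n)
  have hvC : ∀ n, v n ∈ Competitor f M := fun n => hwC _
  have hpt : ∀ x, Tendsto (fun m => v m x) atTop (𝓝 (h x)) := tendsto_pi_nhds.1 hlim
  have hvL : Tendsto (fun n => Ip G p (v n)) atTop (𝓝 L) := by
    have hw : Tendsto (fun n => Ip G p (w n)) atTop (𝓝 L) := by
      refine tendsto_of_tendsto_of_tendsto_of_le_of_le tendsto_const_nhds (h := fun n : ℕ =>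
        L + ((n : ℝ≥0∞) + 1)⁻¹) ?_ (fun n => iInf₂_le (w n) (hwC n)) fun n => (hwL n).le
      have : Tendsto (fun n : ℕ => ((n : ℝ≥0∞) + 1)⁻¹) atTop (𝓝 0) := by
        have := (tendsto_add_atTop_iff_nat 1).2 ENNReal.tendsto_inv_nat_nhds_zero
        simpa using this
      simpa using this.const_add L
    exact hw.comp hφ.tendsto_atTop
  have hbound : ∀ x, |h x| ≤ M := fun x => abs_le.2 (hhM x trivial)
  have hhI : Ip G p h ≠ ∞ := by
    refine ((Ip_le_of_tendsto hp0 hpt (c := L + 1) ?_).trans_lt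
      (ENNReal.add_lt_top.2 ⟨hLtop.lt_top, ENNReal.one_lt_top⟩)).ne
    exact (hvL.eventually (gt_mem_nhds (ENNReal.lt_add_right hLtop one_ne_zero))).mono fun _ => le_of_lt
  refine ⟨h, ⟨⟨hhI, M, hbound⟩, fun x => ?_⟩, v, fun m => (hvC m).1, hpt, ?_⟩
  · have := (hfin x).fintype
    refine pLap_eq_zero_of_forall_le hp x fun s => ?_
    have hsum : ∀ (t : ℕ → ℝ) (c : ℝ), Tendsto t atTop (𝓝 c) →
        Tendsto (fun m => ENNReal.ofReal (∑ y : G.neighborSet x, |v m y - t m| ^ p)) atTop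
          (𝓝 (ENNReal.ofReal (∑ y : G.neighborSet x, |h y - c| ^ p))) := fun t c ht =>
      ENNReal.tendsto_ofReal (tendsto_finsetSum _ fun y _ =>
        ((hpt y).sub ht).abs.rpow_const (Or.inr hp0))
    have hstep : ∀ m, L + 2 * ENNReal.ofReal (∑ y : G.neighborSet x, |v m y - v m x| ^ p) ≤
        Ip G p (v m) + 2 * ENNReal.ofReal (∑ y : G.neighborSet x, |v m y - s| ^ p) := fun m => by
      obtain ⟨R, hR⟩ := exists_Ip_update_eq G p x (v m)
      have h1 := Competitor.iInf_le_Ip_update (G := G) hp0 hM (hvC m) x s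
      have h2 := hR (v m x)
      rw [Function.update_eq_self] at h2
      rw [hR s] at h1
      rw [h2]
      calc _ ≤ _ := add_le_add_left h1 _
        _ = _ := by ring
    have hlim' := le_of_tendsto_of_tendsto'
      (tendsto_const_nhds.add (ENNReal.Tendsto.const_mul (hsum _ _ (hpt x)) (Or.inr (by simp))))
      (hvL.add (ENNReal.Tendsto.const_mul (hsum _ _ tendsto_const_nhds) (Or.inr (by simp)))) hstep
    have := (ENNReal.mul_le_mul_iff_right (by simp) (by simp)).1
      ((ENNReal.add_le_add_iff_left hLtop).1 hlim')
    exact (ENNReal.ofReal_le_ofReal_iff (Finset.sum_nonneg fun _ _ => by positivity)).1 this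
  · have hK : 2 * L + 1 ≠ ∞ := by simp [ENNReal.mul_eq_top, hLtop]
    rw [ENNReal.tendsto_nhds_zero]
    intro ε hε
    obtain ⟨δ, hδ, hδε⟩ : ∃ δ : ℝ, 0 < δ ∧ ENNReal.ofReal δ * (2 * L + 1) ≤ ε := by
      have hq : 0 < ε / (2 * L + 1) := ENNReal.div_pos hε.ne' hK
      obtain ⟨δ, -, hδ0, hδ⟩ := ENNReal.lt_iff_exists_real_btwn.1 hq
      refine ⟨δ, ENNReal.ofReal_pos.1 hδ0, ?_⟩
      exact (ENNReal.le_div_iff_mul_le (Or.inl (by simp)) (Or.inl hK)).1 hδ.le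
    obtain ⟨C, hC, hCδ⟩ := exists_abs_sub_rpow_le hp hδ
    have hCL : ENNReal.ofReal C * L ≠ ∞ := ENNReal.mul_ne_top ENNReal.ofReal_ne_top hLtop
    have hδ0 : ENNReal.ofReal δ ≠ 0 := (ENNReal.ofReal_pos.2 hδ).ne'
    have hη : ∀ᶠ m in atTop, ENNReal.ofReal (δ + C / 2) * (2 * Ip G p (v m)) <
        ENNReal.ofReal δ * (2 * L + 1) + ENNReal.ofReal C * L := by
      have ht : Tendsto (fun m => ENNReal.ofReal (δ + C / 2) * (2 * Ip G p (v m))) atTop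
          (𝓝 (ENNReal.ofReal (δ + C / 2) * (2 * L))) :=
        ENNReal.Tendsto.const_mul (ENNReal.Tendsto.const_mul hvL (Or.inr (by simp)))
          (Or.inr ENNReal.ofReal_ne_top)
      refine ht.eventually (gt_mem_nhds ?_)
      have hC2 : ENNReal.ofReal (C / 2) * 2 = ENNReal.ofReal C := by
        rw [show (2 : ℝ≥0∞) = ENNReal.ofReal 2 by simp, ← ENNReal.ofReal_mul (by positivity),
          div_mul_cancel₀ _ two_ne_zero]
      have hexp : ENNReal.ofReal (δ + C / 2) * (2 * L) =
          ENNReal.ofReal δ * (2 * L) + ENNReal.ofReal C * L := by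
        rw [ENNReal.ofReal_add hδ.le (by positivity), ← hC2]
        ring
      rw [hexp, mul_add, mul_one, add_right_comm]
      refine ENNReal.lt_add_right (ENNReal.add_ne_top.2 ⟨?_, hCL⟩) hδ0
      exact ENNReal.mul_ne_top ENNReal.ofReal_ne_top (ENNReal.mul_ne_top (by simp) hLtop)
    filter_upwards [hη] with m hm
    refine (Ip_le_of_tendsto hp0 (v := fun k x => v k x - v m x)
      (fun x => (hpt x).sub_const _) ?_).trans hδε
    filter_upwards [hη] with k hk
    have h1 := Ip_sub_add_Ip_midpoint_le (G := G) hδ hC hCδ (v k) (v m)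
    have h2 : L ≤ Ip G p fun x => (v k x + v m x) / 2 :=
      iInf₂_le _ (Competitor.midpoint (hvC k) (hvC m))
    have h3 : ENNReal.ofReal (δ + C / 2) * (Ip G p (v k) + Ip G p (v m)) ≤
        ENNReal.ofReal δ * (2 * L + 1) + ENNReal.ofReal C * L := by
      rcases le_total (Ip G p (v k)) (Ip G p (v m)) with hle | hle
      · refine le_trans ?_ hm.le
        rw [two_mul]
        gcongr
      · refine le_trans ?_ hk.le
        rw [two_mul]
        gcongr
    refine (ENNReal.add_le_add_iff_right hCL).1 (le_trans ?_ (h1.trans h3))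
    gcongr

lemma IsComponentOf.eq_of_mem {C C' S : Set V} (hC : IsComponentOf G C S)
    (hC' : IsComponentOf G C' S) {x : V} (hx : x ∈ C) (hx' : x ∈ C') : C = C' := by
  have hconn : ConnectedSubset G (C ∪ C') := SimpleGraph.induce_union_connected
    hC.2.2.1.preconnected hC'.2.2.1.preconnected ⟨x, hx, hx'⟩
  have hsub := Set.union_subset hC.2.1 hC'.2.1
  exact (hC.2.2.2 _ Set.subset_union_left hsub hconn).symm.trans
    (hC'.2.2.2 _ Set.subset_union_right hsub hconn)

lemma finite_setOf_dart_fst_mem (hfin : ∀ x, (G.neighborSet x).Finite) {K : Set V}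
    (hK : K.Finite) : {d : G.Dart | d.fst ∈ K}.Finite := by
  refine ((hK.biUnion fun x _ => (hfin x).image fun y => (x, y)).preimage
    (SimpleGraph.Dart.toProd_injective (G := G)).injOn).subset fun d hd => ?_
  exact Set.mem_biUnion (show d.fst ∈ K from hd) ⟨d.snd, d.adj, rfl⟩

/-- A function constant on the components of the complement of a finite set has finite
Dirichlet sum. -/
lemma Ip_ne_top_of_eq_of_adj (hp : 0 < p) (hfin : ∀ x, (G.neighborSet x).Finite) {K : Set V}
    (hK : K.Finite) {f : V → ℝ} (hf : ∀ x ∉ K, ∀ y ∉ K, G.Adj x y → f x = f y) :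
    Ip G p f ≠ ∞ := by
  have hfst := finite_setOf_dart_fst_mem hfin hK
  have hD : ({d : G.Dart | d.fst ∈ K} ∪ {d : G.Dart | d.snd ∈ K}).Finite := by
    refine hfst.union ((hfst.preimage (dartSymmEquiv G).injective.injOn).subset fun d hd => hd)
  rw [Ip_eq_tsum_dart, tsum_eq_sum (s := hD.toFinset)]
  · exact (ENNReal.sum_lt_top.2 fun _ _ => ENNReal.ofReal_lt_top).ne
  · intro d hd
    simp only [Set.Finite.mem_toFinset, Set.mem_union, Set.mem_ofPred_eq, not_or] at hd
    rw [hf _ hd.1 _ hd.2 d.adj, sub_self, abs_zero, Real.zero_rpow hp.ne', ENNReal.ofReal_zero]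

/-- Existence of bounded `p`-harmonic functions with prescribed boundary values on finitely many
components of the complement of a finite set. -/
lemma exists_mem_BHDp_asympConst [Countable V] (hp : 1 < p)
    (hfin : ∀ x, (G.neighborSet x).Finite) {ι : Type*} [Fintype ι] {K : Set V} (hK : K.Finite)
    {F : ι → Set V} (hF : ∀ i, IsComponentOf G (F i) Kᶜ) (hinj : Function.Injective F)
    (a : ι → ℝ) : ∃ h ∈ BHDp G p, ∀ i, AsympConst G p (F i) h (a i) := by
  classical
  let f : V → ℝ := fun x => ∑ i, if x ∈ F i then a i else 0
  have hfF : ∀ i, ∀ x ∈ F i, f x = a i := fun i x hx => by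
    refine (Finset.sum_eq_single i (fun j _ hj => ?_) (by simp)).trans (if_pos hx)
    exact if_neg fun hxj => hj (hinj ((hF j).eq_of_mem (hF i) hxj hx))
  have hmem : ∀ i, ∀ x ∈ F i, ∀ y ∉ K, G.Adj x y → y ∈ F i := fun i x hx y hy hxy => by
    by_contra hcon
    exact (hF i).outerBoundary_subset ⟨hcon, x, hx, hxy.symm⟩ hy
  have hfBD : f ∈ BDp G p := by
    refine ⟨Ip_ne_top_of_eq_of_adj (by linarith) hfin hK fun x hx y hy hxy => ?_,
      ∑ i, |a i|, fun x => ?_⟩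
    · refine Finset.sum_congr rfl fun i _ => ?_
      rw [if_congr ⟨fun h => hmem i x h y hy hxy, fun h => hmem i y h x hx hxy.symm⟩ rfl rfl]
    · refine (Finset.abs_sum_le_sum_abs _ _).trans (Finset.sum_le_sum fun i _ => ?_)
      split_ifs
      · exact le_rfl
      · simp
  obtain ⟨h, hh, v, hv, hpt, hE⟩ := exists_mem_BHDp_approx hp hfin hfBD
  refine ⟨h, hh, fun i => ?_⟩
  have := almostEvery_tendsto_zero (G := G) (p := p) (by linarith) (Q := pathsIn G (F i))
    (fun γ hγ => hγ.1) (u := fun x => h x - f x) hE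
    (fun x => by simpa using (hpt x).const_sub (h x))
    fun m => (hv m).subset fun x hx hc => hx (by rw [hc])
  refine this.mono fun γ hγ hlim => ?_
  have hlim' := hlim.add_const (a i)
  rw [zero_add] at hlim'
  refine hlim'.congr fun n => ?_
  rw [hfF i _ (hγ.2.2 n)]
  ring

/-- Green's formula for a `p`-harmonic function and a finitely supported test function. -/
lemma hasSum_pFlow_mul (hfin : ∀ x, (G.neighborSet x).Finite) {h : V → ℝ}
    (hh : ∀ x, pLap G p h x = 0) {φ : V → ℝ} (hφ : {x | φ x ≠ 0}.Finite) :
    HasSum (fun d : G.Dart => pFlow p (h d.snd - h d.fst) * (φ d.snd - φ d.fst)) 0 := by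
  set A : G.Dart → ℝ := fun d => pFlow p (h d.snd - h d.fst) * φ d.fst with hA
  have hsum : Summable A := by
    refine summable_of_hasFiniteSupport ((finite_setOf_dart_fst_mem hfin hφ).subset fun d hd => ?_)
    exact right_ne_zero_of_mul hd
  have hzero : HasSum A 0 := by
    have hs : Summable fun c => A (dartEquivSigma G c) := (dartEquivSigma G).summable_iff.2 hsum
    refine hsum.hasSum_iff.2 ?_
    rw [← (dartEquivSigma G).tsum_eq, Summable.tsum_sigma hs]
    refine (tsum_congr fun x => ?_).trans tsum_zero
    refine (tsum_mul_right (a := φ x) (f := fun y : G.neighborSet x => pFlow p (h y - h x))).trans ?_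
    rw [show ∑' y : G.neighborSet x, pFlow p (h y - h x) = 0 from hh x, zero_mul]
  have hsymm : HasSum (fun d : G.Dart => A d.symm) 0 := (dartSymmEquiv G).hasSum_iff.2 hzero
  have := (hsymm.add hzero).neg
  rw [add_zero, neg_zero] at this
  refine this.congr_fun fun d => ?_
  simp only [hA, SimpleGraph.Dart.symm]
  have := pFlow_neg p (h d.snd - h d.fst)
  rw [neg_sub] at this
  simp only [Prod.fst_swap, Prod.snd_swap]
  rw [this]
  ring

lemma summable_abs_sub_rpow {f : V → ℝ} (hf : Ip G p f ≠ ∞) :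
    Summable fun d : G.Dart => |f d.snd - f d.fst| ^ p := by
  rw [Ip_eq_tsum_dart] at hf
  refine (ENNReal.summable_toReal hf).congr fun d => ?_
  exact ENNReal.toReal_ofReal (by positivity)

lemma summable_rpow_sub_one_mul (hp : 1 < p) {ι : Type*} {f g : ι → ℝ} (hf : ∀ i, 0 ≤ f i)
    (hg : ∀ i, 0 ≤ g i) (hfs : Summable fun i => f i ^ p) (hgs : Summable fun i => g i ^ p) :
    Summable fun i => f i ^ (p - 1) * g i := by
  have hpow : ∀ {t : ℝ}, 0 ≤ t → t ^ (p - 1) * t = t ^ p := fun {t} ht => by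
    rw [← Real.rpow_add_one' ht (by linarith), sub_add_cancel]
  refine Summable.of_nonneg_of_le (fun i => ?_) (fun i => ?_) (hfs.add hgs)
  · exact mul_nonneg (Real.rpow_nonneg (hf i) _) (hg i)
  · have h1 := Real.rpow_nonneg (hf i) p
    have h2 := Real.rpow_nonneg (hg i) p
    rcases le_total (g i) (f i) with h | h
    · have := mul_le_mul_of_nonneg_left h (Real.rpow_nonneg (hf i) (p - 1))
      rw [hpow (hf i)] at this
      linarith
    · have := mul_le_mul_of_nonneg_right (Real.rpow_le_rpow (hf i) h (by linarith : 0 ≤ p - 1)) (hg i)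
      rw [hpow (hg i)] at this
      linarith

lemma abs_mul_sub_mul_le {s t a b c r M : ℝ} (hs : 0 ≤ s ∧ s ≤ 1) (ht : 0 ≤ t ∧ t ≤ 1)
    (hab : |b - a| ≤ c) (ha : 0 ≤ a ∧ a ≤ M) (hr : 0 ≤ r)
    (hst : a ≠ 0 → b ≠ 0 → |t - s| ≤ r) : |t * b - s * a| ≤ c + M * r := by
  have hMr : 0 ≤ M * r := mul_nonneg (ha.1.trans ha.2) hr
  have hle : ∀ z : ℝ, 0 ≤ z ∧ z ≤ 1 → |z * (b - a)| ≤ c := fun z hz => by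
    rw [abs_mul, abs_of_nonneg hz.1]
    exact (mul_le_of_le_one_left (abs_nonneg _) hz.2).trans hab
  by_cases ha0 : a = 0
  · have := hle t ht
    rw [ha0, sub_zero] at this
    rw [ha0, mul_zero, sub_zero]
    linarith
  by_cases hb0 : b = 0
  · have := hle s hs
    rw [hb0, zero_sub, mul_neg] at this
    rw [hb0, mul_zero, zero_sub]
    linarith
  have h1 : |(t - s) * a| ≤ M * r := by
    rw [abs_mul, abs_of_nonneg ha.1, mul_comm]
    exact mul_le_mul ha.2 (hst ha0 hb0) (abs_nonneg _) (ha.1.trans ha.2)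
  calc |t * b - s * a| = |t * (b - a) + (t - s) * a| := by ring_nf
    _ ≤ _ := (abs_add_le _ _).trans (add_le_add (hle t ht) h1)

/-- If almost no path stays in the set where `h₁ - h₂` exceeds `ε`, then the truncation of
`h₁ - h₂` at height `ε` has no variation. -/
lemma max_sub_eq_of_adj (hp : 1 < p) (hG : G.Connected) (hfin : ∀ x, (G.neighborSet x).Finite)
    {h₁ h₂ : V → ℝ} (hh₁ : h₁ ∈ BHDp G p) (hh₂ : h₂ ∈ BHDp G p) {ε : ℝ} (hε : 0 < ε)
    (hnull : pModulus G p (pathsIn G {x | ε < h₁ x - h₂ x}) = 0) {x y : V} (hxy : G.Adj x y) :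
    max (h₁ x - h₂ x - ε) 0 = max (h₁ y - h₂ y - ε) 0 := by
  have hp0 : 0 < p := by linarith
  set w : V → ℝ := fun z => h₁ z - h₂ z with hw
  set u : V → ℝ := fun z => max (w z - ε) 0 with hu
  set U : Set V := {z | ε < w z} with hU
  obtain ⟨ρ, hρ, hρE⟩ := exists_admissible_of_pModulus_eq_zero hnull one_pos
  have hρtop : ∀ e ∈ G.edgeSet, ρ e ≠ ∞ := fun e he htop => by
    have := (ENNReal.le_tsum (f := fun e : G.edgeSet => ρ e ^ p) ⟨e, he⟩).trans_lt hρE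
    simp [htop, ENNReal.top_rpow_of_pos hp0] at this
  obtain ⟨ψ, hψ01, hψfin, hψlip, hψ1⟩ := exists_cutoff hG hfin (ρ := fun e => 2 * ρ e)
    (fun e he => ENNReal.mul_ne_top (by simp) (hρtop e he)) (U := U) fun γ hγ => by
      rw [ENNReal.tsum_mul_left]
      calc (1 : ℝ≥0∞) < 2 * 1 := by norm_num
        _ ≤ _ := by gcongr; exact hρ γ hγ
  obtain ⟨M₁, hM₁⟩ := hh₁.1.2
  obtain ⟨M₂, hM₂⟩ := hh₂.1.2
  set M := M₁ + M₂ with hM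
  have huM : ∀ z, 0 ≤ u z ∧ u z ≤ M := fun z => by
    have h1 := abs_le.1 (hM₁ z)
    have h2 := abs_le.1 (hM₂ z)
    refine ⟨le_max_right _ _, max_le ?_ ?_⟩ <;> simp only [hw, hM] <;> linarith
  have huU : ∀ z, u z ≠ 0 → z ∈ U := fun z hz => by
    by_contra hcon
    exact hz (max_eq_right (sub_nonpos.2 (not_lt.1 (show ¬ ε < w z from hcon))))
  have huw : ∀ a b, |u b - u a| ≤ |w b - w a| := fun a b => by
    refine (abs_max_sub_max_le_max _ _ _ _).trans ?_
    simp
  set g : G.Dart → ℝ := fun d =>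
    pFlow p (h₁ d.snd - h₁ d.fst) - pFlow p (h₂ d.snd - h₂ d.fst) with hg
  let D : G.Dart → ℝ := fun d => |h₁ d.snd - h₁ d.fst| + |h₂ d.snd - h₂ d.fst|
    + M * (2 * ρ d.edge).toReal
  let B : G.Dart → ℝ := fun d =>
    |h₁ d.snd - h₁ d.fst| ^ (p - 1) * D d + |h₂ d.snd - h₂ d.fst| ^ (p - 1) * D d
  have hM0 : 0 ≤ M := (huM x).1.trans (huM x).2
  have hD0 : ∀ d, 0 ≤ D d := fun d => by positivity
  have hDs : Summable fun d => D d ^ p := by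
    have hs₁ := summable_abs_sub_rpow hh₁.1.1
    have hs₂ := summable_abs_sub_rpow hh₂.1.1
    refine Real.summable_Lp_add_of_nonneg hp.le (fun _ => by positivity) (fun _ => by positivity)
      (Real.summable_Lp_add_of_nonneg hp.le (fun _ => by positivity) (fun _ => by positivity)
        hs₁ hs₂) ?_
    have htop : ∑' d : G.Dart, ρ d.edge ^ p ≠ ∞ :=
      ((tsum_dart_le_two_mul_tsum_edgeSet fun e => ρ e ^ p).trans_lt
        (ENNReal.mul_lt_top (by simp) (hρE.trans ENNReal.one_lt_top))).ne
    refine ((ENNReal.summable_toReal htop).mul_left ((M * 2) ^ p)).congr fun d => ?_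
    rw [← ENNReal.toReal_rpow, ← Real.mul_rpow (by positivity) ENNReal.toReal_nonneg,
      ENNReal.toReal_mul, ENNReal.toReal_ofNat, mul_assoc]
  have hBs : Summable B :=
    (summable_rpow_sub_one_mul hp (fun _ => abs_nonneg _) hD0 (summable_abs_sub_rpow hh₁.1.1) hDs).add
      (summable_rpow_sub_one_mul hp (fun _ => abs_nonneg _) hD0 (summable_abs_sub_rpow hh₂.1.1) hDs)
  have hgB : ∀ (d : G.Dart) (t : ℝ),
      |t| ≤ |w d.snd - w d.fst| + M * (2 * ρ d.edge).toReal → ‖g d * t‖ ≤ B d := fun d t ht => by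
    have hgd : |g d| ≤ |h₁ d.snd - h₁ d.fst| ^ (p - 1) + |h₂ d.snd - h₂ d.fst| ^ (p - 1) := by
      rw [← abs_pFlow hp, ← abs_pFlow hp]
      exact abs_sub _ _
    have hwd : |w d.snd - w d.fst| ≤ |h₁ d.snd - h₁ d.fst| + |h₂ d.snd - h₂ d.fst| := by
      rw [show w d.snd - w d.fst = (h₁ d.snd - h₁ d.fst) - (h₂ d.snd - h₂ d.fst) by
        simp only [hw]; ring]
      exact abs_sub _ _
    have htD : |t| ≤ D d := ht.trans (by simp only [D]; linarith)
    rw [Real.norm_eq_abs, abs_mul]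
    refine (mul_le_mul hgd htD (abs_nonneg _) (by positivity)).trans_eq ?_
    simp only [B]
    ring
  have hzero : ∀ m, HasSum (fun d : G.Dart => g d * (ψ m d.snd * u d.snd - ψ m d.fst * u d.fst)) 0 :=
    fun m => by
      have hφ : {z | ψ m z * u z ≠ 0}.Finite := (hψfin m).subset fun z hz =>
        ⟨huU z (right_ne_zero_of_mul hz), left_ne_zero_of_mul hz⟩
      have := (hasSum_pFlow_mul hfin hh₁.2 hφ).sub (hasSum_pFlow_mul hfin hh₂.2 hφ)
      rw [sub_zero] at this
      exact this.congr_fun fun d => by simp only [hg]; ring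
  have hlim := tendsto_tsum_of_dominated_convergence (𝓕 := atTop)
    (f := fun m (d : G.Dart) => g d * (ψ m d.snd * u d.snd - ψ m d.fst * u d.fst))
    (g := fun d => g d * (u d.snd - u d.fst)) hBs
    (fun d => tendsto_const_nhds.congr' <| by
      filter_upwards [hψ1 d.fst, hψ1 d.snd] with m h1 h2
      rw [h1, h2, one_mul, one_mul])
    (Eventually.of_forall fun m d => hgB d _ <|
      abs_mul_sub_mul_le (hψ01 m _) (hψ01 m _) (huw _ _) (huM _) ENNReal.toReal_nonneg
        fun ha hb => hψlip m _ (huU _ ha) _ (huU _ hb) d.adj)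
  simp only [(hzero _).tsum_eq] at hlim
  have hsum : Summable fun d : G.Dart => g d * (u d.snd - u d.fst) :=
    Summable.of_norm_bounded hBs fun d => hgB d _ <| (huw _ _).trans <|
      le_add_of_nonneg_right <| mul_nonneg hM0 ENNReal.toReal_nonneg
  have hHS : HasSum (fun d : G.Dart => g d * (u d.snd - u d.fst)) 0 :=
    hsum.hasSum_iff.2 (tendsto_nhds_unique hlim tendsto_const_nhds)
  have humono : ∀ {a b}, w a ≤ w b → u a ≤ u b := fun {a b} h =>
    max_le_max (by linarith) le_rfl
  have hgpos : ∀ d : G.Dart, w d.fst < w d.snd → 0 < g d := fun d h =>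
    sub_pos.2 (pFlow_strictMono hp (by simp only [hw] at h; linarith))
  have hgneg : ∀ d : G.Dart, w d.snd < w d.fst → g d < 0 := fun d h =>
    sub_neg.2 (pFlow_strictMono hp (by simp only [hw] at h; linarith))
  have hterm := (hasSum_zero_iff_of_nonneg fun d => by
    rcases lt_trichotomy (w d.fst) (w d.snd) with h | h | h
    · exact mul_nonneg (hgpos d h).le (sub_nonneg.2 (humono h.le))
    · simp [hu, h]
    · exact mul_nonneg_of_nonpos_of_nonpos (hgneg d h).le (sub_nonpos.2 (humono h.le))).1 hHS
  have hd : g ⟨(x, y), hxy⟩ * (u y - u x) = 0 := congrFun hterm ⟨(x, y), hxy⟩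
  rcases lt_trichotomy (w x) (w y) with h | h | h
  · exact (sub_eq_zero.1 ((mul_eq_zero.1 hd).resolve_left (hgpos ⟨(x, y), hxy⟩ h).ne')).symm
  · exact congrArg (fun t => max (t - ε) 0) h
  · exact (sub_eq_zero.1 ((mul_eq_zero.1 hd).resolve_left (hgneg ⟨(x, y), hxy⟩ h).ne)).symm

/-- Comparison principle: bounded `p`-harmonic functions of finite Dirichlet sum with the same
boundary values on all the infinite components of the complement of a finite set are ordered. -/
lemma le_of_asympConst [Infinite V] (hp : 1 < p) (hG : G.Connected)
    (hfin : ∀ x, (G.neighborSet x).Finite) {ι : Type*} [Countable ι] {K : Set V} (hK : K.Finite)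
    {F : ι → Set V} (hFall : ∀ C : Set V, IsComponentOf G C Kᶜ → C.Infinite → ∃ i, C = F i)
    (hFhyp : ∀ i, pHyperbolic G p (F i)) {a : ι → ℝ} {h₁ h₂ : V → ℝ}
    (hh₁ : h₁ ∈ BHDp G p) (hh₂ : h₂ ∈ BHDp G p)
    (ha₁ : ∀ i, AsympConst G p (F i) h₁ (a i)) (ha₂ : ∀ i, AsympConst G p (F i) h₂ (a i))
    (x : V) : h₁ x ≤ h₂ x := by
  have hp0 : 0 < p := by linarith
  by_contra! hx
  set ε := (h₁ x - h₂ x) / 2 with hε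
  have hε0 : 0 < ε := by linarith
  have hnull : pModulus G p (pathsIn G {x | ε < h₁ x - h₂ x}) = 0 := by
    have hi : ∀ i, pModulus G p {γ ∈ pathsIn G (F i) |
        ¬ Tendsto (fun n => h₁ (γ n) - h₂ (γ n)) atTop (𝓝 0)} = 0 := fun i =>
      ((ha₁ i).and hp0 (ha₂ i)).mono fun γ _ h => by simpa using h.1.sub h.2
    refine le_antisymm ((pModulus_mono_of_tail fun γ hγ => ?_).trans_eq
      (pModulus_iUnion_eq_zero hp0 hi)) zero_le
    obtain ⟨C, k, hC, hCinf, hγC⟩ := IsPathIn.exists_tail_in_component hγ hK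
    obtain ⟨i, rfl⟩ := hFall C hC hCinf
    refine ⟨k, Set.mem_iUnion.2 ⟨i, hγC, fun hlim => ?_⟩⟩
    obtain ⟨m, hm⟩ := (hlim.eventually (gt_mem_nhds hε0)).exists
    exact hm.not_gt (hγ.2.2 _)
  have hwalk : ∀ {y z}, G.Walk y z → max (h₁ y - h₂ y - ε) 0 = max (h₁ z - h₂ z - ε) 0 := by
    intro y z q
    induction q with
    | nil => rfl
    | cons h _ ih => exact (max_sub_eq_of_adj hp hG hfin hh₁ hh₂ hε0 hnull h).trans ih
  have hconst : ∀ y, max (h₁ y - h₂ y - ε) 0 = ε := fun y => by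
    obtain ⟨q⟩ := hG.preconnected x y
    rw [← hwalk q, max_eq_left] <;> linarith
  have hlarge : ∀ y, ε < h₁ y - h₂ y := fun y => by
    by_contra! hcon
    have := hconst y
    rw [max_eq_right (by linarith)] at this
    linarith
  obtain ⟨γ, hγ⟩ := exists_isPathIn_univ hG hfin
  obtain ⟨C, k, hC, hCinf, -⟩ := hγ.exists_tail_in_component hK
  obtain ⟨i, rfl⟩ := hFall C hC hCinf
  refine pModulus_pathsIn_ne_zero hp0 hG hfin hK hC (hFhyp i) (le_antisymm ?_ zero_le)
  rw [← hnull]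
  exact pModulus_mono fun γ hγ => ⟨hγ.1, hγ.2.1, fun n => hlarge _⟩

end PHB

/-- Kim–Lee: if `Γ` has `n` `p`-hyperbolic ends, each with property AC, then
for any reals `a_1, …, a_n` there is a unique `h ∈ BHD_p(Γ)` with
`h(γ) = a_i` for `p`-almost every path `γ ∈ P_{F_i}`. -/
theorem kim_lee {V : Type*} [Countable V] [Infinite V] (G : SimpleGraph V)
    (hG : G.Connected) (hdeg : BoundedDegree G) (p : ℝ) (hp : 1 < p)
    (n : ℕ) (K : Set V) (F : Fin n → Set V) (hK : K.Finite)
    (hFcomp : ∀ i, IsComponentOf G (F i) Kᶜ ∧ (F i).Infinite)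
    (hFinj : Function.Injective F)
    (hFall : ∀ C : Set V, IsComponentOf G C Kᶜ → C.Infinite → ∃ i, C = F i)
    (hFhyp : ∀ i, pHyperbolic G p (F i))
    (hFAC : ∀ i, PropertyAC G p (F i))
    (a : Fin n → ℝ) :
    ∃! h : V → ℝ, h ∈ BHDp G p ∧ ∀ i, AsympConst G p (F i) h (a i) := by
  obtain ⟨h, hh, ha⟩ := exists_mem_BHDp_asympConst hp hdeg.finite_neighborSet hK
    (fun i => (hFcomp i).1) hFinj a
  have hle : ∀ h₁ h₂ : V → ℝ, (h₁ ∈ BHDp G p ∧ ∀ i, AsympConst G p (F i) h₁ (a i)) →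
      (h₂ ∈ BHDp G p ∧ ∀ i, AsympConst G p (F i) h₂ (a i)) → h₁ ≤ h₂ := fun h₁ h₂ H₁ H₂ =>
    le_of_asympConst hp hG hdeg.finite_neighborSet hK hFall hFhyp H₁.1 H₂.1 H₁.2 H₂.2
  exact ⟨h, ⟨hh, ha⟩, fun h' H => le_antisymm (hle _ _ H ⟨hh, ha⟩) (hle _ _ ⟨hh, ha⟩ H)⟩
end
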